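/- Let q ≥ 1 and p ∈ (2q, 2q+1), and let L > 0. If γ ∈ W^{1,1}_{i,r}(𝕋, ℝ^n) is convex with L(γ) = L and satisfies TP^{(p,q)}(γ) = L^{q+2−p} · π^{p−q} · ∫₀¹ sin(πw)^{2q−p} dw, then the image of γ is a round circle. Moreover, this value is a lower bound for TP^{(p,q)} among all convex curves γ ∈ W^{1,1}_{i,r}(𝕋, ℝ^n) with L(γ) = L. -/

import Mathlib

open MeasureTheory Real Set intervalIntegral
open scoped ENNReal RealInnerProductSpace

noncomputable section

/-- A closed `W^{1,1}`-curve on the torus `𝕋 = ℝ/ℤ` with values in `ℝⁿ`, encoded as a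
`1`-periodic absolutely continuous function `toFun : ℝ → ℝⁿ` together with its
(weak) derivative `deriv'`. -/
structure ClosedCurve (n : ℕ) where
  toFun : ℝ → EuclideanSpace ℝ (Fin n)
  deriv' : ℝ → EuclideanSpace ℝ (Fin n)
  periodic : Function.Periodic toFun 1
  deriv'_periodic : Function.Periodic deriv' 1
  integrableOn : MeasureTheory.IntegrableOn deriv' (Set.Icc (0:ℝ) 1)
  eq_integral : ∀ t : ℝ, toFun t = toFun 0 + ∫ s in (0:ℝ)..t, deriv' s

namespace ClosedCurve

variable {n : ℕ}

/-- Injectivity as a map on the torus `ℝ/ℤ`. -/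
def IsInj (γ : ClosedCurve n) : Prop :=
  ∀ s t : ℝ, γ.toFun s = γ.toFun t → ∃ k : ℤ, s - t = (k : ℝ)

/-- Regularity: the derivative does not vanish a.e. -/
def IsRegular (γ : ClosedCurve n) : Prop := ∀ᵐ t : ℝ ∂volume, γ.deriv' t ≠ 0

/-- Parametrization by arc length: `|γ'| = 1` a.e. -/
def IsArclength (γ : ClosedCurve n) : Prop := ∀ᵐ t : ℝ ∂volume, ‖γ.deriv' t‖ = 1

/-- The length of a closed curve. -/
def length (γ : ClosedCurve n) : ℝ := ∫ t in (0:ℝ)..1, ‖γ.deriv' t‖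

end ClosedCurve

/-- Orthogonal projection onto the orthogonal complement of `span {v}` (for `v ≠ 0`). -/
def projPerp {F : Type*} [NormedAddCommGroup F] [InnerProductSpace ℝ F] (v x : F) : F :=
  x - (⟪v, x⟫ / ‖v‖ ^ 2) • v

/-- The Gauss map `φ_γ(u,w)`: the unit secant direction. -/
def gaussMap {n : ℕ} (γ : ClosedCurve n) (u w : ℝ) : EuclideanSpace ℝ (Fin n) :=
  ‖γ.toFun (u + w) - γ.toFun u‖⁻¹ • (γ.toFun (u + w) - γ.toFun u)

/-- `|∂_u φ_γ(u,w)|`, expressed via the identity (1.8) of the paper. -/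
def gaussDerivU {n : ℕ} (γ : ClosedCurve n) (u w : ℝ) : ℝ :=
  ‖projPerp (gaussMap γ u w) (γ.deriv' (u + w) - γ.deriv' u)‖ /
    ‖γ.toFun (u + w) - γ.toFun u‖

/-- `|∂_w φ_γ(u,w)|`, expressed via the identity (1.7) of the paper. -/
def gaussDerivW {n : ℕ} (γ : ClosedCurve n) (u w : ℝ) : ℝ :=
  ‖projPerp (gaussMap γ u w) (γ.deriv' (u + w))‖ / ‖γ.toFun (u + w) - γ.toFun u‖

/-- The generalized tangent-point energy `TP^{(p,q)}` (with values in `[0,∞]`). -/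
def TP {n : ℕ} (p q : ℝ) (γ : ClosedCurve n) : ℝ≥0∞ :=
  ∫⁻ u in Set.Ioc (0:ℝ) 1, ∫⁻ w in Set.Ioc (0:ℝ) 1,
    ENNReal.ofReal
      (‖projPerp (γ.deriv' u) (γ.toFun (u + w) - γ.toFun u)‖ ^ q /
        ‖γ.toFun (u + w) - γ.toFun u‖ ^ p * (‖γ.deriv' u‖ * ‖γ.deriv' (u + w)‖))

/-- The minorant `G^{(p,q)}_w`. -/
def Gw {n : ℕ} (p q : ℝ) (γ : ClosedCurve n) (w : ℝ) : ℝ≥0∞ :=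
  ∫⁻ u in Set.Ioc (0:ℝ) 1,
    ENNReal.ofReal ((1/2 * gaussDerivU γ u w) ^ q *
      ‖γ.toFun (u + w) - γ.toFun u‖ ^ (2*q - p))

/-- The minorant `G^{(p,q)}`. -/
def G {n : ℕ} (p q : ℝ) (γ : ClosedCurve n) : ℝ≥0∞ :=
  ∫⁻ w in Set.Ioc (0:ℝ) 1, Gw p q γ w

/-- A round circle in a euclidean space: a sphere intersected with a 2-dimensional plane
through its center. -/
def IsCircle {F : Type*} [NormedAddCommGroup F] [InnerProductSpace ℝ F] (S : Set F) : Prop :=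
  ∃ (c : F) (r : ℝ) (V : Submodule ℝ F), 0 < r ∧ Module.finrank ℝ V = 2 ∧
    S = {x | ‖x - c‖ = r ∧ x - c ∈ V}

/-- A great circle of the unit sphere. -/
def IsGreatCircle {F : Type*} [NormedAddCommGroup F] [InnerProductSpace ℝ F]
    (S : Set F) : Prop :=
  ∃ V : Submodule ℝ F, Module.finrank ℝ V = 2 ∧ S = {x | ‖x‖ = 1 ∧ x ∈ V}

/-- Half of a great circle of the unit sphere: a great-circle arc of angular length `π`. -/
def IsHalfGreatCircle {F : Type*} [NormedAddCommGroup F] [InnerProductSpace ℝ F]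
    (S : Set F) : Prop :=
  ∃ a b : F, ‖a‖ = 1 ∧ ‖b‖ = 1 ∧ ⟪a, b⟫ = 0 ∧
    S = (fun t : ℝ => Real.cos t • a + Real.sin t • b) '' Set.Icc 0 π

/-- A curve is convex if its image is the boundary (within its affine hull) of a convex
planar (2-dimensional) set. -/
def ClosedCurve.IsConvex {n : ℕ} (γ : ClosedCurve n) : Prop :=
  ∃ K : Set (EuclideanSpace ℝ (Fin n)), Convex ℝ K ∧
    Module.finrank ℝ (affineSpan ℝ K).direction = 2 ∧
    Set.range γ.toFun = intrinsicFrontier ℝ K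

theorem eq_mul_exp_integral_logDeriv {c c' : ℝ → ℂ} {a b C : ℝ} (hab : a ≤ b)
    (hm : Measurable c') (hC : ∀ t, ‖c' t‖ ≤ C) (hc : ∀ t, c t = c a + ∫ s in a..t, c' s)
    (hne : ∀ t ∈ Icc a b, c t ≠ 0) :
    IntervalIntegrable (fun s => c' s / c s) volume a b ∧
      ∀ t ∈ Icc a b, c t = c a * Complex.exp (∫ s in a..t, c' s / c s) := by
  have hint : ∀ x y, IntervalIntegrable c' volume x y := fun x y =>
    (intervalIntegrable_const (c := C)).mono_fun' hm.aestronglyMeasurable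
      (Filter.Eventually.of_forall hC)
  have hlip : ∀ x y, ‖c x - c y‖ ≤ C * |x - y| := by
    intro x y
    have : c x - c y = ∫ s in y..x, c' s := by
      rw [hc x, hc y, add_sub_add_left_eq_sub, integral_interval_sub_left (hint _ _) (hint _ _)]
    rw [this]
    exact norm_integral_le_of_norm_le_const fun t _ => hC t
  have hC0 : 0 ≤ C := (norm_nonneg _).trans (hC 0)
  have hLip : LipschitzWith ⟨C, hC0⟩ c := LipschitzWith.of_dist_le_mul fun x y => by
    rw [dist_eq_norm, Real.dist_eq]; exact hlip x y
  have hcont := hLip.continuous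
  obtain ⟨x0, hx0, hmin⟩ := isCompact_Icc.exists_isMinOn (nonempty_Icc.2 hab)
    (hcont.norm.continuousOn (s := Icc a b))
  have hpos : 0 < ‖c x0‖ := norm_pos_iff.2 (hne x0 hx0)
  set D := C / ‖c x0‖ with hD
  have hD0 : 0 ≤ D := by positivity
  have hbd : ∀ t ∈ Icc a b, ‖c' t / c t‖ ≤ D := fun t ht => by
    rw [norm_div]
    exact div_le_div₀ hC0 (hC t) hpos (hmin ht)
  have hgm : Measurable fun s => c' s / c s := hm.div hcont.measurable
  have hg : IntervalIntegrable (fun s => c' s / c s) volume a b := by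
    refine (intervalIntegrable_const (c := D)).mono_fun' hgm.aestronglyMeasurable ?_
    rw [uIoc_of_le hab]
    filter_upwards [ae_restrict_mem measurableSet_Ioc] with t ht
    exact hbd t (Ioc_subset_Icc_self ht)
  refine ⟨hg, ?_⟩
  obtain ⟨E, hE⟩ : ∃ E : ℝ → ℂ, E = fun t => ∫ s in a..t, c' s / c s := ⟨_, rfl⟩
  have hgi : ∀ x ∈ Icc a b, ∀ y ∈ Icc a b,
      IntervalIntegrable (fun s => c' s / c s) volume x y := fun x hx y hy =>
    hg.mono_set (by rw [uIcc_of_le hab]; exact uIcc_subset_Icc hx hy)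
  have hElip : LipschitzOnWith ⟨D, hD0⟩ E (Icc a b) := LipschitzOnWith.of_dist_le_mul
    fun x hx y hy => by
      have haI : a ∈ Icc a b := left_mem_Icc.2 hab
      rw [dist_eq_norm, Real.dist_eq, hE]
      simp only
      rw [integral_interval_sub_left (hgi _ haI _ hx) (hgi _ haI _ hy)]
      refine norm_integral_le_of_norm_le_const fun t ht => hbd t ?_
      exact uIcc_subset_Icc hy hx (uIoc_subset_uIcc ht)
  obtain ⟨R, hR⟩ := (isCompact_Icc.image_of_continuousOn hElip.continuousOn).isBounded.subset_closedBall 0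
  have hexp : ContDiff ℝ 1 fun x : ℂ => Complex.exp (-x) := Complex.contDiff_exp.comp contDiff_neg
  obtain ⟨K, hK⟩ := (hexp.locallyLipschitz.locallyLipschitzOn
    (s := Metric.closedBall (0:ℂ) R)).exists_lipschitzOnWith_of_compact (isCompact_closedBall _ _)
  have hcomp : LipschitzOnWith (K * ⟨D, hD0⟩) (fun t => Complex.exp (-E t)) (Icc a b) :=
    hK.comp hElip fun t ht => hR (mem_image_of_mem _ ht)
  have hAC1 : AbsolutelyContinuousOnInterval (fun t => Complex.exp (-E t)) a b := by
    rw [← uIcc_of_le hab] at hcomp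
    exact hcomp.absolutelyContinuousOnInterval
  have hAC2 : AbsolutelyContinuousOnInterval c a b :=
    (hLip.lipschitzOnWith (s := uIcc a b)).absolutelyContinuousOnInterval
  have hAC : AbsolutelyContinuousOnInterval (fun t => Complex.exp (-E t) * c t) a b :=
    hAC1.smul hAC2
  obtain ⟨k, hk⟩ := hAC.const_of_ae_hasDerivAt_zero (by
    filter_upwards [(hint a b).ae_hasDerivAt_integral, hg.ae_hasDerivAt_integral] with x h1 h2 hx
    have h1' : HasDerivAt c (c' x) x := by
      have := (h1 hx a left_mem_uIcc).const_add (c a)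
      rwa [← funext hc] at this
    have h2a : HasDerivAt E (c' x / c x) x := by rw [hE]; exact h2 hx a left_mem_uIcc
    have h2' : HasDerivAt (fun t => Complex.exp (-E t) * c t)
        (Complex.exp (-E x) * (-(c' x / c x)) * c x + Complex.exp (-E x) * c' x) x :=
      h2a.neg.cexp.mul h1'
    have hcx : c x ≠ 0 := hne x (by rwa [uIcc_of_le hab] at hx)
    have h0 : Complex.exp (-E x) * (-(c' x / c x)) * c x + Complex.exp (-E x) * c' x = 0 := by
      rw [mul_assoc, neg_mul, div_mul_cancel₀ _ hcx]
      ring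
    rw [h0] at h2'
    exact h2')
  rw [uIcc_of_le hab] at hk
  intro t ht
  have h1 := hk a (left_mem_Icc.2 hab)
  have h2 := hk t ht
  rw [← h1] at h2
  have hEa : E a = 0 := by simp [hE]
  rw [hEa] at h2
  simp only [neg_zero, Complex.exp_zero, one_mul] at h2
  change c t = c a * Complex.exp ((fun t => ∫ s in a..t, c' s / c s) t)
  rw [← hE]
  rw [← h2, mul_right_comm, ← Complex.exp_add]
  simp

/-- A simple closed planar curve of length one, parametrized by arc length. -/
structure UnitLoop where
  z : ℝ → ℂ
  ζ : ℝ → ℂ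
  meas : Measurable ζ
  norm_one : ∀ t, ‖ζ t‖ = 1
  z_per : Function.Periodic z 1
  ζ_per : Function.Periodic ζ 1
  eq_int : ∀ t, z t = z 0 + ∫ s in (0:ℝ)..t, ζ s
  inj : ∀ s t, z s = z t → ∃ k : ℤ, s - t = k

namespace UnitLoop

variable (c : UnitLoop)

theorem intervalIntegrable (x y : ℝ) : IntervalIntegrable c.ζ volume x y :=
  (intervalIntegrable_const (c := (1:ℝ))).mono_fun' c.meas.aestronglyMeasurable
    (Filter.Eventually.of_forall fun t => (c.norm_one t).le)

theorem z_sub (s t : ℝ) : c.z t - c.z s = ∫ x in s..t, c.ζ x := by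
  rw [c.eq_int t, c.eq_int s, add_sub_add_left_eq_sub,
    integral_interval_sub_left (c.intervalIntegrable _ _) (c.intervalIntegrable _ _)]

theorem norm_z_sub_le (s t : ℝ) : ‖c.z t - c.z s‖ ≤ |t - s| := by
  rw [c.z_sub]
  simpa using norm_integral_le_of_norm_le_const (C := 1) (f := c.ζ) (a := s) (b := t)
    fun x _ => (c.norm_one x).le

theorem continuous_z : Continuous c.z :=
  (LipschitzWith.of_dist_le_mul (K := 1) fun x y => by
    simpa [dist_eq_norm, Real.norm_eq_abs] using c.norm_z_sub_le y x).continuous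

theorem locallyIntegrable : LocallyIntegrable c.ζ volume :=
  (locallyIntegrable_const (1:ℝ)).mono c.meas.aestronglyMeasurable
    (Filter.Eventually.of_forall fun t => by simp [c.norm_one t])

theorem ae_hasDerivAt : ∀ᵐ u : ℝ, HasDerivAt c.z (c.ζ u) u := by
  filter_upwards [LocallyIntegrable.ae_hasDerivAt_integral c.locallyIntegrable] with u hu
  have := (hu 0).const_add (c.z 0)
  rwa [← funext c.eq_int] at this

/-- The secant vector of a loop. -/
def chord (u w : ℝ) : ℂ := c.z (u + w) - c.z u

theorem chord_ne_zero {w : ℝ} (u : ℝ) (h0 : 0 < w) (h1 : w < 1) : c.chord u w ≠ 0 := by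
  intro h
  obtain ⟨k, hk⟩ := c.inj (u + w) u (sub_eq_zero.1 h)
  rw [add_sub_cancel_left] at hk
  rw [hk] at h0 h1
  have h2 : 0 < k := by exact_mod_cast h0
  have h3 : k < 1 := by exact_mod_cast h1
  omega

theorem norm_chord_pos {w : ℝ} (u : ℝ) (h0 : 0 < w) (h1 : w < 1) : 0 < ‖c.chord u w‖ :=
  norm_pos_iff.2 (c.chord_ne_zero u h0 h1)

theorem continuous_chord : Continuous fun x : ℝ × ℝ => c.chord x.1 x.2 := by
  have := c.continuous_z
  unfold chord
  fun_prop

/-- The tangent-point energy density of a loop. -/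
def density (p q u w : ℝ) : ℝ :=
  |(starRingEnd ℂ (c.ζ u) * c.chord u w).im| ^ q / ‖c.chord u w‖ ^ p

/-- The tangent-point energy of a loop. -/
def energy (p q : ℝ) : ℝ≥0∞ :=
  ∫⁻ u in Ioc (0:ℝ) 1, ∫⁻ w in Ioc (0:ℝ) 1, ENNReal.ofReal (c.density p q u w)

theorem measurable_density (p q : ℝ) : Measurable fun x : ℝ × ℝ => c.density p q x.1 x.2 := by
  have h := c.continuous_chord.measurable
  have := c.meas
  unfold density
  have h2 : Measurable fun x : ℝ × ℝ => starRingEnd ℂ (c.ζ x.1) * c.chord x.1 x.2 :=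
    (Complex.continuous_conj.measurable.comp (this.comp measurable_fst)).mul h
  have h3 := Complex.measurable_im.comp h2
  exact ((continuous_abs.measurable.comp h3).pow_const q).div (h.norm.pow_const p)

theorem density_nonneg (p q u w : ℝ) : 0 ≤ c.density p q u w := by
  unfold density; positivity

theorem chord_eq_int (u w : ℝ) : c.chord u w = ∫ v in (0:ℝ)..w, c.ζ (u + v) := by
  rw [chord, z_sub, integral_comp_add_left, add_zero]

theorem chord_periodic (w : ℝ) : Function.Periodic (fun u => c.chord u w) 1 := fun u => by
  have h : u + 1 + w = u + w + 1 := by ring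
  simp only [chord]
  rw [h, c.z_per, c.z_per]

end UnitLoop

/-- A loop that lies to the left of almost all of its tangent lines. -/
structure UnitConvexLoop extends UnitLoop where
  supp : ∀ᵐ u : ℝ, ∀ t, 0 ≤ (starRingEnd ℂ (ζ u) * (z t - z u)).im

theorem Complex.im_div_eq (a b : ℂ) : (a / b).im = (starRingEnd ℂ a * (-b)).im / ‖b‖ ^ 2 := by
  rw [Complex.div_im, ← Complex.normSq_eq_norm_sq]
  simp
  ring

theorem ae_add_left {P : ℝ → Prop} (h : ∀ᵐ t, P t) (u : ℝ) : ∀ᵐ v, P (u + v) :=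
  (measurePreserving_add_left volume u).quasiMeasurePreserving.ae h

namespace UnitConvexLoop

open UnitLoop

variable (c : UnitConvexLoop)

/-- The angular velocity of the secant direction with respect to the end point. -/
def angVel (u v : ℝ) : ℝ := (c.ζ (u + v) / c.chord u v).im

/-- The angle between the tangent and the secant. -/
def angle (u w : ℝ) : ℝ := ∫ v in (0:ℝ)..w, c.angVel u v

theorem measurable_angVel : Measurable fun x : ℝ × ℝ => c.angVel x.1 x.2 := by
  have h := c.continuous_chord.measurable
  have := c.meas
  unfold angVel
  fun_prop

theorem ae_angVel_nonneg (u : ℝ) : ∀ᵐ v : ℝ, 0 ≤ c.angVel u v := by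
  filter_upwards [ae_add_left c.supp u] with v hv
  rw [angVel, Complex.im_div_eq, chord, neg_sub]
  exact div_nonneg (hv u) (by positivity)

theorem chord_eq_exp {ε w : ℝ} (u : ℝ) (h0 : 0 < ε) (h : ε ≤ w) (h1 : w < 1) :
    IntervalIntegrable (c.angVel u) volume ε w ∧
    ∀ v ∈ Icc ε w, ((‖c.chord u v‖⁻¹ : ℝ) : ℂ) * c.chord u v = ((‖c.chord u ε‖⁻¹ : ℝ) : ℂ) *
      c.chord u ε * Complex.exp ((∫ x in ε..v, c.angVel u x : ℝ) * Complex.I) := by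
  have hm : Measurable fun v => c.ζ (u + v) := c.meas.comp (measurable_const_add u)
  have hii : ∀ x y, IntervalIntegrable (fun v => c.ζ (u + v)) volume x y := fun x y =>
    (intervalIntegrable_const (c := (1:ℝ))).mono_fun' hm.aestronglyMeasurable
    (Filter.Eventually.of_forall fun t => (c.norm_one _).le)
  obtain ⟨hi, hx⟩ := eq_mul_exp_integral_logDeriv (c := c.chord u) (c' := fun v => c.ζ (u + v))
    (a := ε) (b := w) (C := 1) h hm (fun t => (c.norm_one _).le) (fun t => by
      rw [c.chord_eq_int, c.chord_eq_int, integral_add_adjacent_intervals (hii _ _) (hii _ _)])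
    (fun t ht => c.chord_ne_zero u (h0.trans_le ht.1) (ht.2.trans_lt h1))
  have him : IntervalIntegrable (c.angVel u) volume ε w := ⟨hi.1.im, hi.2.im⟩
  refine ⟨him, fun v hv => ?_⟩
  have hiv : IntervalIntegrable (fun s => c.ζ (u + s) / c.chord u s) volume ε v :=
    hi.mono_set (by rw [uIcc_of_le h, uIcc_of_le hv.1]; exact Icc_subset_Icc_right hv.2)
  have hI : (∫ x in ε..v, c.angVel u x) = (∫ s in ε..v, c.ζ (u + s) / c.chord u s).im :=
    (Complex.imCLM.intervalIntegral_comp_comm hiv)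
  have hv' := hx v hv
  set J := ∫ s in ε..v, c.ζ (u + s) / c.chord u s with hJ
  have hn : ‖c.chord u v‖ = ‖c.chord u ε‖ * Real.exp J.re := by
    rw [hv', norm_mul, Complex.norm_exp]
  have hpos := c.norm_chord_pos u h0 (h.trans_lt h1)
  have hJe : Complex.exp J = Complex.exp (J.re : ℂ) * Complex.exp ((J.im : ℂ) * Complex.I) := by
    rw [← Complex.exp_add, Complex.re_add_im]
  rw [hI, hn, hv', hJe]
  have : Complex.exp (J.re : ℂ) ≠ 0 := Complex.exp_ne_zero _
  have h2 : ((‖c.chord u ε‖ : ℝ) : ℂ) ≠ 0 := by exact_mod_cast hpos.ne'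
  push_cast
  field_simp

end UnitConvexLoop

namespace UnitConvexLoop

open UnitLoop

variable (c : UnitConvexLoop)

theorem integral_angVel_le_pi {u : ℝ} (hs : ∀ t, 0 ≤ (starRingEnd ℂ (c.ζ u) * (c.z t - c.z u)).im)
    {ε w : ℝ} (h0 : 0 < ε) (h : ε ≤ w) (h1 : w < 1) : ∫ v in ε..w, c.angVel u v ≤ π := by
  obtain ⟨hi, hx⟩ := c.chord_eq_exp u h0 h h1
  set e : ℝ → ℂ := fun v => starRingEnd ℂ (c.ζ u) * (((‖c.chord u v‖⁻¹ : ℝ) : ℂ) * c.chord u v)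
    with he
  have him : ∀ v, 0 ≤ (e v).im := fun v => by
    have : e v = ((‖c.chord u v‖⁻¹ : ℝ) : ℂ) * (starRingEnd ℂ (c.ζ u) * c.chord u v) := by
      rw [he]; ring
    rw [this, Complex.im_ofReal_mul]
    exact mul_nonneg (by positivity) (hs _)
  have hnorm : ‖e ε‖ = 1 := by
    simp only [he, norm_mul, RCLike.norm_conj, c.norm_one, one_mul, Complex.norm_real, norm_inv,
      norm_norm]
    exact inv_mul_cancel₀ (c.norm_chord_pos u h0 (h.trans_lt h1)).ne'
  set ψ := (e ε).arg with hψ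
  have hψ0 : 0 ≤ ψ := Complex.arg_nonneg_iff.2 (him ε)
  have hψ1 : ψ ≤ π := Complex.arg_le_pi _
  have hee : e ε = Complex.exp (ψ * Complex.I) := by
    have := Complex.norm_mul_exp_arg_mul_I (e ε)
    rw [hnorm] at this
    simpa using this.symm
  have hsin : ∀ v ∈ Icc ε w, 0 ≤ Real.sin (ψ + ∫ x in ε..v, c.angVel u x) := by
    intro v hv
    have h3 : e v = e ε * Complex.exp ((∫ x in ε..v, c.angVel u x : ℝ) * Complex.I) := by
      simp only [he]
      rw [hx v hv]
      ring
    have h4 := him v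
    rw [h3, hee, ← Complex.exp_add, ← add_mul, ← Complex.ofReal_add, Complex.exp_ofReal_mul_I_im]
      at h4
    exact h4
  have hcont : ContinuousOn (fun v => ψ + ∫ x in ε..v, c.angVel u x) (Icc ε w) := by
    have := continuousOn_primitive_interval' hi left_mem_uIcc
    rw [uIcc_of_le h] at this
    exact continuousOn_const.add this
  by_contra! hlt
  have hmem : min (ψ + ∫ x in ε..w, c.angVel u x) (3 * π / 2) ∈
      Icc (ψ + ∫ x in ε..ε, c.angVel u x) (ψ + ∫ x in ε..w, c.angVel u x) := by
    have := pi_pos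
    refine ⟨?_, min_le_left _ _⟩
    rw [integral_same, add_zero]
    exact le_min (by linarith) (by linarith)
  obtain ⟨v, hv, hv2⟩ := intermediate_value_Icc h hcont hmem
  have h5 := hsin v hv
  simp only at hv2
  rw [hv2] at h5
  have h6 : π < min (ψ + ∫ x in ε..w, c.angVel u x) (3 * π / 2) :=
    lt_min (by linarith) (by linarith [pi_pos])
  have h7 := min_le_right (ψ + ∫ x in ε..w, c.angVel u x) (3 * π / 2)
  have h8 : 0 < Real.sin (min (ψ + ∫ x in ε..w, c.angVel u x) (3 * π / 2) - π) :=
    Real.sin_pos_of_pos_of_lt_pi (by linarith) (by linarith [pi_pos])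
  rw [Real.sin_sub_pi] at h8
  linarith

theorem intervalIntegrable_angVel {u : ℝ}
    (hs : ∀ t, 0 ≤ (starRingEnd ℂ (c.ζ u) * (c.z t - c.z u)).im) :
    IntervalIntegrable (c.angVel u) volume 0 1 := by
  rw [intervalIntegrable_iff_integrableOn_Ioc_of_le zero_le_one]
  have h3 : ∀ n : ℕ, (3:ℝ) ≤ n + 3 := fun n => by linarith [n.cast_nonneg (α := ℝ)]
  have hε : ∀ n : ℕ, 0 < ((n:ℝ) + 3)⁻¹ ∧ ((n:ℝ) + 3)⁻¹ ≤ 1 - ((n:ℝ) + 3)⁻¹ := fun n => by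
    have h4 : ((n:ℝ) + 3)⁻¹ ≤ 3⁻¹ := inv_anti₀ (by norm_num) (h3 n)
    exact ⟨by positivity, by norm_num at h4 ⊢; linarith⟩
  have ht : Filter.Tendsto (fun n : ℕ => ((n:ℝ) + 3)⁻¹) Filter.atTop (nhds 0) :=
    tendsto_inv_atTop_zero.comp
      (Filter.tendsto_atTop_add_const_right _ _ tendsto_natCast_atTop_atTop)
  refine MeasureTheory.integrableOn_Ioc_of_intervalIntegral_norm_bounded (I := π) (l := Filter.atTop)
    (a := fun n : ℕ => ((n:ℝ) + 3)⁻¹) (b := fun n : ℕ => 1 - ((n:ℝ) + 3)⁻¹) (fun n => ?_) ht ?_ ?_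
  · have := (c.chord_eq_exp u (hε n).1 (hε n).2 (by linarith [(hε n).1])).1
    exact this.1
  · simpa using ht.const_sub 1
  · refine Filter.Eventually.of_forall fun n => ?_
    refine le_trans (le_of_eq ?_) (c.integral_angVel_le_pi hs (hε n).1 (hε n).2
      (by linarith [(hε n).1]))
    rw [integral_of_le (hε n).2]
    refine integral_congr_ae (ae_restrict_of_ae ?_)
    filter_upwards [c.ae_angVel_nonneg u] with v hv
    exact Real.norm_of_nonneg hv

theorem tendsto_unit_chord {u : ℝ} (hd : HasDerivAt c.z (c.ζ u) u) :
    Filter.Tendsto (fun ε => ((‖c.chord u ε‖⁻¹ : ℝ) : ℂ) * c.chord u ε) (nhdsWithin 0 (Ioi 0))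
      (nhds (c.ζ u)) := by
  have h := hd.tendsto_slope_zero_right
  have h2 : Filter.Tendsto (fun t : ℝ => ((‖t⁻¹ • (c.z (u + t) - c.z u)‖⁻¹ : ℝ) : ℂ) *
      (t⁻¹ • (c.z (u + t) - c.z u))) (nhdsWithin 0 (Ioi 0))
      (nhds (((‖c.ζ u‖⁻¹ : ℝ) : ℂ) * c.ζ u)) := by
    refine Filter.Tendsto.mul ?_ h
    exact (Complex.continuous_ofReal.tendsto _).comp (h.norm.inv₀ (by simp [c.norm_one]))
  rw [c.norm_one] at h2
  simp only [inv_one, Complex.ofReal_one, one_mul] at h2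
  refine h2.congr' ?_
  filter_upwards [self_mem_nhdsWithin] with t ht
  have ht : (0:ℝ) < t := ht
  have ht' : (t : ℂ) ≠ 0 := by exact_mod_cast ht.ne'
  rw [norm_smul, chord, Complex.real_smul, norm_inv, Real.norm_of_nonneg ht.le]
  push_cast
  field_simp

theorem angle_spec {u : ℝ} (hd : HasDerivAt c.z (c.ζ u) u)
    (hs : ∀ t, 0 ≤ (starRingEnd ℂ (c.ζ u) * (c.z t - c.z u)).im) :
    c.angle u 1 ≤ π ∧ ∀ w, 0 < w → w < 1 → 0 ≤ c.angle u w ∧ c.angle u w ≤ π ∧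
      ((‖c.chord u w‖⁻¹ : ℝ) : ℂ) * c.chord u w = c.ζ u * Complex.exp (c.angle u w * Complex.I) := by
  have hi := c.intervalIntegrable_angVel hs
  have hcont : ContinuousOn (c.angle u) (Icc 0 1) := by
    have := continuousOn_primitive_interval' hi left_mem_uIcc
    rwa [uIcc_of_le zero_le_one] at this
  have hii : ∀ x ∈ Icc (0:ℝ) 1, ∀ y ∈ Icc (0:ℝ) 1,
      IntervalIntegrable (c.angVel u) volume x y := fun x hx y hy =>
    hi.mono_set (by rw [uIcc_of_le zero_le_one]; exact uIcc_subset_Icc hx hy)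
  have hz : (0:ℝ) ∈ Icc (0:ℝ) 1 := ⟨le_rfl, zero_le_one⟩
  have hsub : ∀ x ∈ Icc (0:ℝ) 1, ∀ y ∈ Icc (0:ℝ) 1,
      ∫ v in x..y, c.angVel u v = c.angle u y - c.angle u x := fun x hx y hy =>
    (integral_interval_sub_left (hii _ hz _ hy) (hii _ hz _ hx)).symm
  have hmono : ∀ x ∈ Icc (0:ℝ) 1, ∀ y ∈ Icc (0:ℝ) 1, x ≤ y → c.angle u x ≤ c.angle u y := by
    intro x hx y hy hxy
    rw [← sub_nonneg, ← hsub x hx y hy]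
    exact integral_nonneg_of_ae_restrict hxy (ae_restrict_of_ae (c.ae_angVel_nonneg u))
  have hz0 : c.angle u 0 = 0 := integral_same
  have hto0 : Filter.Tendsto (c.angle u) (nhdsWithin 0 (Ioi 0)) (nhds 0) := by
    have := (hcont 0 hz).tendsto.mono_left (nhdsWithin_mono 0 Ioo_subset_Icc_self)
    rwa [hz0, nhdsWithin_Ioo_eq_nhdsGT zero_lt_one] at this
  have hlt : ∀ w, 0 < w → w < 1 → c.angle u w ≤ π := by
    intro w h0 h1
    have hl : Filter.Tendsto (fun ε => c.angle u w - c.angle u ε) (nhdsWithin 0 (Ioi 0))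
        (nhds (c.angle u w - 0)) := tendsto_const_nhds.sub hto0
    rw [sub_zero] at hl
    refine le_of_tendsto hl ?_
    filter_upwards [self_mem_nhdsWithin, nhdsWithin_le_nhds (Iio_mem_nhds h0)] with ε hε hεw
    have hε : 0 < ε := hε
    have hεw : ε < w := hεw
    rw [← hsub ε ⟨hε.le, by linarith⟩ w ⟨h0.le, h1.le⟩]
    exact c.integral_angVel_le_pi hs hε hεw.le h1
  have hone : (1:ℝ) ∈ Icc (0:ℝ) 1 := ⟨zero_le_one, le_rfl⟩
  have hpi : c.angle u 1 ≤ π := by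
    have := (hcont 1 hone).tendsto.mono_left (nhdsWithin_mono 1 Ioo_subset_Icc_self)
    rw [nhdsWithin_Ioo_eq_nhdsLT zero_lt_one] at this
    refine le_of_tendsto this ?_
    filter_upwards [self_mem_nhdsWithin, nhdsWithin_le_nhds (Ioi_mem_nhds zero_lt_one)] with w h1 h0
    exact hlt w h0 h1
  refine ⟨hpi, fun w h0 h1 => ?_⟩
  have hw : w ∈ Icc (0:ℝ) 1 := ⟨h0.le, h1.le⟩
  refine ⟨hz0 ▸ hmono 0 hz w hw h0.le, (hmono w hw 1 ⟨zero_le_one, le_rfl⟩ h1.le).trans hpi, ?_⟩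
  have hlim : Filter.Tendsto (fun ε => ((‖c.chord u ε‖⁻¹ : ℝ) : ℂ) * c.chord u ε *
      Complex.exp (((c.angle u w - c.angle u ε : ℝ) : ℂ) * Complex.I)) (nhdsWithin 0 (Ioi 0))
      (nhds (c.ζ u * Complex.exp (((c.angle u w - 0 : ℝ) : ℂ) * Complex.I))) := by
    refine (c.tendsto_unit_chord hd).mul ?_
    have hc : Continuous fun x : ℝ => Complex.exp (((c.angle u w - x : ℝ) : ℂ) * Complex.I) := by
      fun_prop
    exact (hc.tendsto 0).comp hto0
  rw [sub_zero] at hlim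
  refine tendsto_nhds_unique (tendsto_const_nhds.congr' ?_) hlim
  filter_upwards [self_mem_nhdsWithin, nhdsWithin_le_nhds (Iio_mem_nhds h0)] with ε hε hεw
  have hε : 0 < ε := hε
  have hεw : ε < w := hεw
  rw [(c.chord_eq_exp u hε hεw.le h1).2 w ⟨hεw.le, le_rfl⟩,
    hsub ε ⟨hε.le, by linarith⟩ w hw]

end UnitConvexLoop

namespace UnitConvexLoop

open UnitLoop

variable (c : UnitConvexLoop)

/-- The angular velocity of the secant direction with respect to the starting point, for fixed
end point. -/
def startVel (u w : ℝ) : ℝ := -(c.ζ u / c.chord u w).im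

theorem angVel_periodic (w : ℝ) : Function.Periodic (fun u => c.angVel u w) 1 := fun u => by
  have h : u + 1 + w = u + w + 1 := by ring
  have h2 := c.chord_periodic w u
  simp only at h2
  simp only [angVel]
  rw [h, c.ζ_per, h2]

theorem startVel_eq (u w : ℝ) : c.startVel u w = c.angVel (u + w) (1 - w) := by
  have h : u + w + (1 - w) = u + 1 := by ring
  rw [startVel, angVel, chord, chord, h, c.z_per, c.ζ_per, ← neg_sub, div_neg, Complex.neg_im, neg_neg]

theorem exists_le_norm_chord {w : ℝ} (h0 : 0 < w) (h1 : w < 1) :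
    ∃ m > 0, ∀ u, m ≤ ‖c.chord u w‖ := by
  have hc : Continuous fun u => ‖c.chord u w‖ :=
    (c.continuous_chord.comp (Continuous.prodMk continuous_id continuous_const)).norm
  obtain ⟨x0, hx0, hmin⟩ := isCompact_Icc.exists_isMinOn (nonempty_Icc.2 (zero_le_one (α := ℝ)))
    hc.continuousOn
  refine ⟨_, c.norm_chord_pos x0 h0 h1, fun u => ?_⟩
  obtain ⟨y, hy, hy2⟩ := (c.chord_periodic w).exists_mem_Ico₀ zero_lt_one u
  rw [hy2]
  exact hmin (Ico_subset_Icc_self hy)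

theorem measurable_chord (w : ℝ) : Measurable fun u => c.chord u w :=
  c.continuous_chord.measurable.comp (measurable_id.prodMk measurable_const)

theorem exists_bound_vel {w : ℝ} (h0 : 0 < w) (h1 : w < 1) :
    ∃ B, ∀ s u, ‖c.ζ s / c.chord u w‖ ≤ B := by
  obtain ⟨m, hm, h⟩ := c.exists_le_norm_chord h0 h1
  refine ⟨m⁻¹, fun s u => ?_⟩
  rw [norm_div, c.norm_one, one_div]
  exact inv_anti₀ hm (h u)

theorem intervalIntegrable_div_chord {w : ℝ} (h0 : 0 < w) (h1 : w < 1) (r x y : ℝ) :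
    IntervalIntegrable (fun u => c.ζ (u + r) / c.chord u w) volume x y := by
  obtain ⟨B, hB⟩ := c.exists_bound_vel h0 h1
  refine (intervalIntegrable_const (c := B)).mono_fun' ?_ (Filter.Eventually.of_forall fun u => hB _ u)
  exact ((c.meas.comp (measurable_add_const r)).div (c.measurable_chord w)).aestronglyMeasurable

theorem intervalIntegrable_angVel_left {w : ℝ} (h0 : 0 < w) (h1 : w < 1) (x y : ℝ) :
    IntervalIntegrable (fun u => c.angVel u w) volume x y :=
  ⟨(c.intervalIntegrable_div_chord h0 h1 w x y).1.im, (c.intervalIntegrable_div_chord h0 h1 w x y).2.im⟩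

theorem intervalIntegrable_startVel {w : ℝ} (h0 : 0 < w) (h1 : w < 1) (x y : ℝ) :
    IntervalIntegrable (fun u => c.startVel u w) volume x y := by
  have h := c.intervalIntegrable_div_chord h0 h1 0 x y
  simp only [add_zero] at h
  exact ⟨h.1.im.neg, h.2.im.neg⟩

/-- Mean angular velocity. -/
def meanVel (w : ℝ) : ℝ := ∫ u in (0:ℝ)..1, c.angVel u w

theorem integral_startVel (w : ℝ) : ∫ u in (0:ℝ)..1, c.startVel u w = c.meanVel (1 - w) := by
  simp only [startVel_eq, meanVel]
  rw [integral_comp_add_right (fun u => c.angVel u (1 - w))]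
  have := (c.angVel_periodic (1 - w)).intervalIntegral_add_eq w 0
  simpa [add_comm] using this

theorem ae_angVel_nonneg_left (w : ℝ) : ∀ᵐ u : ℝ, 0 ≤ c.angVel u w := by
  filter_upwards [ae_add_left c.supp w] with u hu
  rw [angVel, Complex.im_div_eq, chord, neg_sub, add_comm]
  exact div_nonneg (hu u) (by positivity)

theorem startVel_eq_div (u w : ℝ) :
    c.startVel u w = (starRingEnd ℂ (c.ζ u) * c.chord u w).im / ‖c.chord u w‖ ^ 2 := by
  rw [startVel, Complex.im_div_eq, mul_neg, Complex.neg_im, neg_div, neg_neg]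

theorem ae_startVel_nonneg (w : ℝ) : ∀ᵐ u : ℝ, 0 ≤ c.startVel u w := by
  filter_upwards [c.supp] with u hu
  rw [startVel_eq_div]
  exact div_nonneg (hu _) (by positivity)

theorem integral_chord (w : ℝ) : ∫ u in (0:ℝ)..1, c.chord u w = 0 := by
  have hz : ∀ x y, IntervalIntegrable c.z volume x y := fun x y =>
    c.continuous_z.intervalIntegrable _ _
  have hz2 : IntervalIntegrable (fun u => c.z (u + w)) volume 0 1 :=
    (c.continuous_z.comp (continuous_add_const w)).intervalIntegrable _ _
  simp only [chord]
  rw [integral_sub hz2 (hz _ _), integral_comp_add_right]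
  have := c.z_per.intervalIntegral_add_eq w 0
  rw [sub_eq_zero]
  simpa [add_comm] using this

theorem two_pi_le_meanVel {w : ℝ} (h0 : 0 < w) (h1 : w < 1) :
    2 * π ≤ c.meanVel w + c.meanVel (1 - w) := by
  have hm : Measurable fun v => c.ζ (v + w) - c.ζ v :=
    (c.meas.comp (measurable_add_const w)).sub c.meas
  have hb : ∀ v, ‖c.ζ (v + w) - c.ζ v‖ ≤ 2 := fun v => by
    refine (norm_sub_le _ _).trans ?_
    rw [c.norm_one, c.norm_one]
    norm_num
  have hij : ∀ x y, IntervalIntegrable (fun v => c.ζ (v + w)) volume x y := fun x y =>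
    (intervalIntegrable_const (c := (1:ℝ))).mono_fun'
      (c.meas.comp (measurable_add_const w)).aestronglyMeasurable
      (Filter.Eventually.of_forall fun t => (c.norm_one _).le)
  obtain ⟨hI, hx⟩ := eq_mul_exp_integral_logDeriv (c := fun t => c.chord t w)
    (c' := fun v => c.ζ (v + w) - c.ζ v) (a := 0) (b := 1) (C := 2) zero_le_one hm hb (fun t => by
      rw [integral_sub (hij _ _) (c.intervalIntegrable _ _), integral_comp_add_right,
        ← c.z_sub, ← c.z_sub, chord, chord]
      ring) (fun t _ => c.chord_ne_zero t h0 h1)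
  have him : ∀ t ∈ Icc (0:ℝ) 1, (∫ s in (0:ℝ)..t, (c.ζ (s + w) - c.ζ s) / c.chord s w).im =
      (∫ s in (0:ℝ)..t, c.angVel s w) + ∫ s in (0:ℝ)..t, c.startVel s w := fun t ht => by
    rw [← integral_add (c.intervalIntegrable_angVel_left h0 h1 _ _)
      (c.intervalIntegrable_startVel h0 h1 _ _)]
    refine (Complex.imCLM.intervalIntegral_comp_comm (hI.mono_set (by
      rw [uIcc_of_le ht.1, uIcc_of_le zero_le_one]; exact Icc_subset_Icc_right ht.2))).symm.trans ?_
    refine integral_congr fun s _ => ?_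
    simp only [Complex.imCLM_apply, sub_div, Complex.sub_im, angVel, startVel]
    ring
  have hnn : ∀ x y, x ≤ y →
      0 ≤ (∫ s in x..y, c.angVel s w) + ∫ s in x..y, c.startVel s w := fun x y hxy =>
    add_nonneg (integral_nonneg_of_ae_restrict hxy (ae_restrict_of_ae (c.ae_angVel_nonneg_left w)))
      (integral_nonneg_of_ae_restrict hxy (ae_restrict_of_ae (c.ae_startVel_nonneg w)))
  have hone := hx 1 ⟨zero_le_one, le_rfl⟩
  have hper : c.chord 1 w = c.chord 0 w := by simpa using c.chord_periodic w 0
  rw [hper, eq_comm, mul_eq_left₀ (c.chord_ne_zero 0 h0 h1), Complex.exp_eq_one_iff] at hone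
  obtain ⟨n, hn⟩ := hone
  have h1' := him 1 ⟨zero_le_one, le_rfl⟩
  rw [hn, integral_startVel] at h1'
  have h2 : ((n : ℂ) * (2 * π * Complex.I)).im = n * (2 * π) := by simp
  rw [h2] at h1'
  change _ = c.meanVel w + _ at h1'
  rw [← h1']
  have hn0 : (0:ℝ) ≤ n * (2 * π) := by
    have := hnn 0 1 zero_le_one
    rwa [integral_startVel, ← meanVel, ← h1'] at this
  have hn1 : (0:ℝ) ≤ n := nonneg_of_mul_nonneg_left hn0 (by positivity)
  have hn2 : (0:ℤ) ≤ n := by exact_mod_cast hn1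
  rcases hn2.eq_or_lt with hz | hpos
  · exfalso
    have hzero : ∀ t ∈ Icc (0:ℝ) 1,
        (∫ s in (0:ℝ)..t, (c.ζ (s + w) - c.ζ s) / c.chord s w).im = 0 := fun t ht => by
      rw [him t ht]
      have ha := hnn 0 t ht.1
      have hb := hnn t 1 ht.2
      have e1 := integral_add_adjacent_intervals (c.intervalIntegrable_angVel_left h0 h1 0 t)
        (c.intervalIntegrable_angVel_left h0 h1 t 1)
      have e2 := integral_add_adjacent_intervals (c.intervalIntegrable_startVel h0 h1 0 t)
        (c.intervalIntegrable_startVel h0 h1 t 1)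
      rw [integral_startVel] at e2
      rw [← meanVel] at e1
      rw [← hz] at h1'
      simp only [Int.cast_zero, zero_mul] at h1'
      linarith
    have hcc : Continuous fun t => c.chord t w :=
      c.continuous_chord.comp (Continuous.prodMk continuous_id continuous_const)
    have hcont : Continuous fun t => starRingEnd ℂ (c.chord 0 w) * c.chord t w :=
      continuous_const.mul hcc
    have hpos : 0 < ∫ t in (0:ℝ)..1, (starRingEnd ℂ (c.chord 0 w) * c.chord t w).re := by
      refine intervalIntegral_pos_of_pos_on
        ((Complex.continuous_re.comp hcont).intervalIntegrable _ _) (fun t ht => ?_) zero_lt_one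
      have htt : t ∈ Icc (0:ℝ) 1 := Ioo_subset_Icc_self ht
      have h3 := hx t htt
      have h4 := hzero t htt
      obtain ⟨J, hJ⟩ : ∃ J, J = ∫ s in (0:ℝ)..t, (c.ζ (s + w) - c.ζ s) / c.chord s w := ⟨_, rfl⟩
      rw [← hJ] at h3 h4
      rw [h3, ← mul_assoc, ← Complex.normSq_eq_conj_mul_self, Complex.re_ofReal_mul, Complex.exp_re,
        h4, Real.cos_zero, mul_one]
      have := Complex.normSq_pos.2 (c.chord_ne_zero 0 h0 h1)
      positivity
    have h5 : ∫ t in (0:ℝ)..1, (starRingEnd ℂ (c.chord 0 w) * c.chord t w).re =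
        (∫ t in (0:ℝ)..1, starRingEnd ℂ (c.chord 0 w) * c.chord t w).re :=
      Complex.reCLM.intervalIntegral_comp_comm (hcont.intervalIntegrable _ _)
    rw [h5, intervalIntegral.integral_const_mul, integral_chord] at hpos
    simp at hpos
  · have : (1:ℝ) ≤ n := by exact_mod_cast hpos
    nlinarith [pi_pos]

end UnitConvexLoop

namespace UnitConvexLoop

open UnitLoop

variable (c : UnitConvexLoop)

theorem integrable_angVel : Integrable (fun x : ℝ × ℝ => c.angVel x.1 x.2)
    ((volume.restrict (Ioc 0 1)).prod (volume.restrict (Ioc 0 1))) := by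
  have hm : AEStronglyMeasurable (fun x : ℝ × ℝ => c.angVel x.1 x.2)
      ((volume.restrict (Ioc 0 1)).prod (volume.restrict (Ioc 0 1))) :=
    c.measurable_angVel.aestronglyMeasurable
  rw [integrable_prod_iff hm]
  refine ⟨ae_restrict_of_ae ?_, ?_⟩
  · filter_upwards [c.supp] with u hu
    exact (c.intervalIntegrable_angVel hu).1
  · refine (integrable_const π).mono' hm.norm.integral_prod_right' (ae_restrict_of_ae ?_)
    filter_upwards [c.supp, c.ae_hasDerivAt] with u hu hd
    rw [Real.norm_of_nonneg (integral_nonneg fun _ => norm_nonneg _)]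
    refine le_trans (le_of_eq ?_) (c.angle_spec hd hu).1
    rw [angle, integral_of_le zero_le_one]
    refine integral_congr_ae (ae_restrict_of_ae ?_)
    filter_upwards [c.ae_angVel_nonneg u] with v hv
    exact Real.norm_of_nonneg hv

theorem intervalIntegrable_meanVel : IntervalIntegrable c.meanVel volume 0 1 := by
  rw [intervalIntegrable_iff_integrableOn_Ioc_of_le zero_le_one]
  have h : c.meanVel = fun v => ∫ u in Ioc (0:ℝ) 1, c.angVel u v := by
    funext v
    rw [meanVel, integral_of_le zero_le_one]
  rw [h]
  exact c.integrable_angVel.integral_prod_right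

theorem integrable_angVel_Ioc {w : ℝ} (h1 : w ≤ 1) :
    Integrable (Function.uncurry c.angVel)
      ((volume.restrict (Ioc 0 1)).prod (volume.restrict (Ioc 0 w))) := by
  refine c.integrable_angVel.mono_measure (Measure.prod_mono le_rfl ?_)
  exact Measure.restrict_mono (Ioc_subset_Ioc_right h1) le_rfl

theorem intervalIntegrable_angle {w : ℝ} (h0 : 0 ≤ w) (h1 : w ≤ 1) :
    IntervalIntegrable (fun u => c.angle u w) volume 0 1 := by
  rw [intervalIntegrable_iff_integrableOn_Ioc_of_le zero_le_one]
  simp only [angle, integral_of_le h0]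
  exact (c.integrable_angVel_Ioc h1).integral_prod_left

theorem integral_angle {w : ℝ} (h0 : 0 ≤ w) (h1 : w ≤ 1) :
    ∫ u in (0:ℝ)..1, c.angle u w = ∫ v in (0:ℝ)..w, c.meanVel v := by
  simp only [angle, meanVel, integral_of_le h0, integral_of_le zero_le_one]
  exact integral_integral_swap (c.integrable_angVel_Ioc h1)

theorem integral_meanVel_le : ∫ v in (0:ℝ)..1, c.meanVel v ≤ π := by
  rw [← c.integral_angle zero_le_one le_rfl]
  have := integral_mono_ae_restrict zero_le_one (c.intervalIntegrable_angle zero_le_one le_rfl)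
    (intervalIntegrable_const (c := π)) (ae_restrict_of_ae (by
      filter_upwards [c.supp, c.ae_hasDerivAt] with u hu hd
      exact (c.angle_spec hd hu).1))
  simpa using this

theorem intervalIntegrable_meanVel_sub :
    IntervalIntegrable (fun w => c.meanVel (1 - w)) volume 0 1 := by
  have := c.intervalIntegrable_meanVel.comp_sub_left 1
  simp only [sub_zero, sub_self] at this
  exact this.symm

theorem ae_meanVel_add : ∀ᵐ w : ℝ, w ∈ Ioo (0:ℝ) 1 → c.meanVel w + c.meanVel (1 - w) = 2 * π := by
  have hi : IntervalIntegrable (fun w => c.meanVel w + c.meanVel (1 - w) - 2 * π) volume 0 1 :=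
    (c.intervalIntegrable_meanVel.add c.intervalIntegrable_meanVel_sub).sub intervalIntegrable_const
  have hz : ∫ w in (0:ℝ)..1, (c.meanVel w + c.meanVel (1 - w) - 2 * π) ≤ 0 := by
    rw [integral_sub (c.intervalIntegrable_meanVel.add c.intervalIntegrable_meanVel_sub)
      intervalIntegrable_const, integral_add c.intervalIntegrable_meanVel
      c.intervalIntegrable_meanVel_sub, integral_comp_sub_left]
    have := c.integral_meanVel_le
    simp
    linarith
  have hnn : ∀ᵐ w ∂volume.restrict (Ioo (0:ℝ) 1),
      0 ≤ c.meanVel w + c.meanVel (1 - w) - 2 * π := by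
    filter_upwards [ae_restrict_mem measurableSet_Ioo] with w hw
    linarith [c.two_pi_le_meanVel hw.1 hw.2]
  rw [integral_of_le zero_le_one, integral_Ioc_eq_integral_Ioo] at hz
  have hi' : IntegrableOn (fun w => c.meanVel w + c.meanVel (1 - w) - 2 * π) (Ioo 0 1) :=
    hi.1.mono_set Ioo_subset_Ioc_self
  have h0 := (integral_eq_zero_iff_of_nonneg_ae hnn hi').1
    (le_antisymm hz (integral_nonneg_of_ae hnn))
  filter_upwards [(ae_restrict_iff' measurableSet_Ioo).1 h0] with w hw hw2
  have := hw hw2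
  simp only [Pi.zero_apply] at this
  linarith

theorem integral_meanVel_add {w : ℝ} (h0 : 0 ≤ w) (h1 : w ≤ 1) :
    ∫ v in (0:ℝ)..w, (c.meanVel v + c.meanVel (1 - v)) = 2 * π * w := by
  have : ∫ v in (0:ℝ)..w, (c.meanVel v + c.meanVel (1 - v)) = ∫ v in (0:ℝ)..w, 2 * π := by
    rw [integral_of_le h0, integral_of_le h0, integral_Ioc_eq_integral_Ioo,
      integral_Ioc_eq_integral_Ioo]
    refine setIntegral_congr_ae measurableSet_Ioo ?_
    filter_upwards [c.ae_meanVel_add] with v hv hv2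
    exact hv (Ioo_subset_Ioo_right h1 hv2)
  rw [this]
  simp
  ring

theorem integral_angle_sub {w : ℝ} (h0 : 0 ≤ w) (h1 : w ≤ 1) :
    (∫ u in (0:ℝ)..1, c.angle u w) - ∫ u in (0:ℝ)..1, c.angle u (1 - w) = 2 * π * w - π := by
  have hi := c.intervalIntegrable_meanVel
  have hsub : ∀ x ∈ Icc (0:ℝ) 1, ∀ y ∈ Icc (0:ℝ) 1, IntervalIntegrable c.meanVel volume x y :=
    fun x hx y hy => hi.mono_set (by rw [uIcc_of_le zero_le_one]; exact uIcc_subset_Icc hx hy)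
  have hi2 := c.intervalIntegrable_meanVel_sub
  have hsub2 : ∀ x ∈ Icc (0:ℝ) 1, ∀ y ∈ Icc (0:ℝ) 1,
      IntervalIntegrable (fun v => c.meanVel (1 - v)) volume x y :=
    fun x hx y hy => hi2.mono_set (by rw [uIcc_of_le zero_le_one]; exact uIcc_subset_Icc hx hy)
  have z : (0:ℝ) ∈ Icc (0:ℝ) 1 := by simp
  have o : (1:ℝ) ∈ Icc (0:ℝ) 1 := by simp
  have hw : w ∈ Icc (0:ℝ) 1 := ⟨h0, h1⟩
  have hw' : 1 - w ∈ Icc (0:ℝ) 1 := ⟨by linarith, by linarith⟩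
  have e1 := c.integral_meanVel_add zero_le_one le_rfl
  have e2 := c.integral_meanVel_add h0 h1
  rw [integral_add (hsub _ z _ o) (hsub2 _ z _ o), integral_comp_sub_left] at e1
  rw [integral_add (hsub _ z _ hw) (hsub2 _ z _ hw), integral_comp_sub_left] at e2
  simp only [sub_zero, sub_self, mul_one] at e1 e2
  have e3 := integral_add_adjacent_intervals (hsub _ z _ hw') (hsub _ hw' _ o)
  rw [c.integral_angle h0 h1, c.integral_angle hw'.1 hw'.2]
  linarith

end UnitConvexLoop

theorem linear_le_rpow_mul_rpow_neg {q s X Z : ℝ} (hq : 1 ≤ q) (hs : 0 < s) (hX : 0 < X)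
    (hZ : 0 < Z) : 1 - q + (q + s) * X - s * Z ≤ X ^ (q + s) * Z ^ (-s) := by
  have hqs : 0 < q + s := by linarith
  have h := Real.geom_mean_le_arith_mean3_weighted (w₁ := 1 / (q + s)) (w₂ := (q - 1) / (q + s))
    (w₃ := s / (q + s)) (p₁ := X ^ (q + s) * Z ^ (-s)) (p₂ := 1) (p₃ := Z) (by positivity)
    (div_nonneg (by linarith) hqs.le) (by positivity) (by positivity) zero_le_one hZ.le
    (by field_simp; ring)
  have e : (X ^ (q + s) * Z ^ (-s)) ^ (1 / (q + s)) * 1 ^ ((q - 1) / (q + s)) *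
      Z ^ (s / (q + s)) = X := by
    rw [Real.one_rpow, mul_one, Real.mul_rpow (by positivity) (by positivity), ← Real.rpow_mul hX.le,
      ← Real.rpow_mul hZ.le, mul_assoc, ← Real.rpow_add hZ]
    have h1 : (q + s) * (1 / (q + s)) = 1 := by field_simp
    have h2 : -s * (1 / (q + s)) + s / (q + s) = 0 := by ring
    rw [h1, h2, Real.rpow_one, Real.rpow_zero, mul_one]
  rw [e] at h
  have h3 := mul_le_mul_of_nonneg_left h hqs.le
  have h4 : (q + s) * (1 / (q + s) * (X ^ (q + s) * Z ^ (-s)) + (q - 1) / (q + s) * 1 +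
      s / (q + s) * Z) = X ^ (q + s) * Z ^ (-s) + (q - 1) + s * Z := by
    field_simp
  rw [h4] at h3
  linarith

theorem sin_lt_tangent {a b : ℝ} (ha0 : 0 ≤ a) (ha : a ≤ π) (hb0 : 0 < b) (hb : b < π)
    (hab : a ≠ b) : Real.sin a < Real.sin b + Real.cos b * (a - b) := by
  rcases hab.lt_or_gt with h | h
  · have := strictConcaveOn_sin_Icc.lt_slope_of_hasDerivAt ⟨ha0, ha⟩ ⟨hb0.le, hb.le⟩ h
      (Real.hasDerivAt_sin b)
    rw [slope_def_field, lt_div_iff₀ (by linarith)] at this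
    linarith
  · have := strictConcaveOn_sin_Icc.slope_lt_of_hasDerivAt ⟨hb0.le, hb.le⟩ ⟨ha0, ha⟩ h
      (Real.hasDerivAt_sin b)
    rw [slope_def_field, div_lt_iff₀ (by linarith)] at this
    linarith

theorem ofReal_integral_le_lintegral_ofReal {α : Type*} [MeasurableSpace α] {μ : Measure α}
    {f l : α → ℝ} (hf : AEStronglyMeasurable f μ) (hf0 : 0 ≤ᵐ[μ] f) (hl : Integrable l μ)
    (hlf : l ≤ᵐ[μ] f) : ENNReal.ofReal (∫ x, l x ∂μ) ≤ ∫⁻ x, ENNReal.ofReal (f x) ∂μ := by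
  by_cases h : ∫⁻ x, ENNReal.ofReal (f x) ∂μ = ∞
  · rw [h]; exact le_top
  · have hi : Integrable f μ := (lintegral_ofReal_ne_top_iff_integrable hf hf0).1 h
    rw [← ofReal_integral_eq_lintegral_ofReal hi hf0]
    exact ENNReal.ofReal_le_ofReal (integral_mono_ae hl hi hlf)

theorem ae_eq_of_lintegral_add_lintegral_le {α : Type*} [MeasurableSpace α] {μ : Measure α}
    {f l f' l' : α → ℝ} (hf : AEStronglyMeasurable f μ) (hf0 : 0 ≤ᵐ[μ] f) (hl : Integrable l μ)
    (hlf : l ≤ᵐ[μ] f) (hf' : AEStronglyMeasurable f' μ) (hf0' : 0 ≤ᵐ[μ] f') (hl' : Integrable l' μ)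
    (hlf' : l' ≤ᵐ[μ] f') (h0 : 0 ≤ (∫ x, l x ∂μ) + ∫ x, l' x ∂μ)
    (h : (∫⁻ x, ENNReal.ofReal (f x) ∂μ) + ∫⁻ x, ENNReal.ofReal (f' x) ∂μ ≤
      ENNReal.ofReal ((∫ x, l x ∂μ) + ∫ x, l' x ∂μ)) : l =ᵐ[μ] f := by
  have ht := (ENNReal.add_ne_top.1 (ne_top_of_le_ne_top ENNReal.ofReal_ne_top h))
  have hi : Integrable f μ := (lintegral_ofReal_ne_top_iff_integrable hf hf0).1 ht.1
  have hi' : Integrable f' μ := (lintegral_ofReal_ne_top_iff_integrable hf' hf0').1 ht.2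
  rw [← ofReal_integral_eq_lintegral_ofReal hi hf0, ← ofReal_integral_eq_lintegral_ofReal hi' hf0',
    ← ENNReal.ofReal_add (integral_nonneg_of_ae hf0) (integral_nonneg_of_ae hf0'),
    ENNReal.ofReal_le_ofReal_iff h0] at h
  have h1 := integral_mono_ae hl hi hlf
  have h2 := integral_mono_ae hl' hi' hlf'
  exact (integral_eq_iff_of_ae_le hl hi hlf).1 (by linarith)

namespace UnitConvexLoop

open UnitLoop

variable (c : UnitConvexLoop)

/-- The energy density of the circle of length one. -/
def circleDensity (q s w : ℝ) : ℝ := π ^ (q + s) * Real.sin (π * w) ^ (-s)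

/-- A minorant of the energy density. -/
def minorant (q s u w : ℝ) : ℝ := circleDensity q s w * (1 - q - s + (q + s) * (c.startVel u w / π)
  - s * (Real.cos (π * w) / Real.sin (π * w)) * (c.angle u w - π * w))

theorem sin_pi_mul_pos {w : ℝ} (h0 : 0 < w) (h1 : w < 1) : 0 < Real.sin (π * w) :=
  Real.sin_pos_of_pos_of_lt_pi (by positivity) (by nlinarith [pi_pos])

theorem circleDensity_pos (q s : ℝ) {w : ℝ} (h0 : 0 < w) (h1 : w < 1) :
    0 < circleDensity q s w := by
  have := sin_pi_mul_pos h0 h1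
  unfold circleDensity
  positivity

theorem minorant_le {q s u w : ℝ} (hq : 1 ≤ q) (hs : 0 < s) (hd : HasDerivAt c.z (c.ζ u) u)
    (hs' : ∀ t, 0 ≤ (starRingEnd ℂ (c.ζ u) * (c.z t - c.z u)).im) (h0 : 0 < w) (h1 : w < 1) :
    c.minorant q s u w ≤ c.density (2 * q + s) q u w ∧
      (c.minorant q s u w = c.density (2 * q + s) q u w → c.angle u w = π * w) := by
  obtain ⟨ha0, ha1, hch⟩ := (c.angle_spec hd hs').2 w h0 h1
  have hd0 := c.norm_chord_pos u h0 h1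
  have hσ := sin_pi_mul_pos h0 h1
  have hF := circleDensity_pos q s h0 h1
  have hpi := pi_pos
  set a := c.angle u w with ha
  set d := ‖c.chord u w‖ with hdd
  have hch2 : c.chord u w = d * (c.ζ u * Complex.exp (a * Complex.I)) := by
    rw [← hch, ← mul_assoc, ← Complex.ofReal_mul, mul_inv_cancel₀ hd0.ne']
    simp
  have him : (starRingEnd ℂ (c.ζ u) * c.chord u w).im = d * Real.sin a := by
    have : starRingEnd ℂ (c.ζ u) * c.chord u w = (d : ℂ) * Complex.exp (a * Complex.I) := by
      have h2 : starRingEnd ℂ (c.ζ u) * c.ζ u = 1 := by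
        rw [mul_comm, Complex.mul_conj, Complex.normSq_eq_norm_sq, c.norm_one]; simp
      rw [hch2]
      linear_combination (d : ℂ) * Complex.exp (a * Complex.I) * h2
    rw [this, Complex.im_ofReal_mul, Complex.exp_ofReal_mul_I_im]
  have hS0 : 0 ≤ Real.sin a := Real.sin_nonneg_of_nonneg_of_le_pi ha0 ha1
  have hv : c.startVel u w = Real.sin a / d := by
    rw [startVel_eq_div, him, ← hdd]
    field_simp
  have hden : c.density (2 * q + s) q u w = (d * Real.sin a) ^ q / d ^ (2 * q + s) := by
    rw [density, him, abs_of_nonneg (by positivity)]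
  have key : circleDensity q s w * (1 - q + (q + s) * (Real.sin a / (π * d)) -
      s * (Real.sin a / Real.sin (π * w))) ≤ c.density (2 * q + s) q u w := by
    rcases hS0.eq_or_lt with hz | hpos
    · rw [hden, ← hz]
      simp only [zero_div, mul_zero, add_zero, sub_zero]
      rw [Real.zero_rpow (by linarith), zero_div]
      exact mul_nonpos_of_nonneg_of_nonpos hF.le (by linarith)
    · refine (mul_le_mul_of_nonneg_left (linear_le_rpow_mul_rpow_neg hq hs
        (X := Real.sin a / (π * d)) (Z := Real.sin a / Real.sin (π * w)) (by positivity)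
        (by positivity)) hF.le).trans (le_of_eq ?_)
      rw [hden, circleDensity, Real.div_rpow hS0 (by positivity), Real.div_rpow hS0 hσ.le,
        Real.mul_rpow hpi.le hd0.le, Real.mul_rpow hd0.le hS0, Real.rpow_add hpos, Real.rpow_neg hS0,
        Real.rpow_neg hσ.le, Real.rpow_add hd0 (2 * q), two_mul, Real.rpow_add hd0 q q,
        Real.rpow_add hd0]
      have e1 : 0 < Real.sin a ^ s := by positivity
      have e2 : 0 < Real.sin (π * w) ^ s := by positivity
      have e3 : 0 < d ^ s := by positivity
      have e4 : 0 < d ^ q := by positivity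
      have e5 : 0 < π ^ (q + s) := by positivity
      field_simp
  have hrel : c.minorant q s u w = circleDensity q s w * (1 - q + (q + s) * (Real.sin a / (π * d)) -
      s * (Real.sin a / Real.sin (π * w))) - circleDensity q s w * s / Real.sin (π * w) *
      (Real.sin (π * w) + Real.cos (π * w) * (a - π * w) - Real.sin a) := by
    rw [minorant, hv, ← ha]
    field_simp
    ring
  have hco : 0 < circleDensity q s w * s / Real.sin (π * w) := by positivity
  by_cases hab : a = π * w
  · refine ⟨?_, fun _ => hab⟩
    rw [hrel, hab]
    rw [hab] at key
    simpa using key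
  · have := sin_lt_tangent ha0 ha1 (by positivity) (by nlinarith) hab
    have h3 : c.minorant q s u w < c.density (2 * q + s) q u w := by
      rw [hrel]
      have := mul_pos hco (sub_pos.2 this)
      linarith
    exact ⟨h3.le, fun h => absurd h h3.ne⟩

end UnitConvexLoop

theorem intervalIntegrable_sin_pi_mul_rpow {s : ℝ} (hs : 0 < s) (h1 : s < 1) :
    IntervalIntegrable (fun w => Real.sin (π * w) ^ (-s)) volume 0 1 := by
  have h : IntervalIntegrable (fun w : ℝ => w ^ (-s)) volume 0 1 :=
    intervalIntegrable_rpow' (by linarith)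
  have h' : IntervalIntegrable (fun w : ℝ => (1 - w) ^ (-s)) volume 0 1 := by
    have := h.comp_sub_left 1
    simp only [sub_zero, sub_self] at this
    exact this.symm
  refine (h.add h').mono_fun' ?_ ?_
  · exact ((Real.measurable_sin.comp (measurable_const_mul π)).pow_const _).aestronglyMeasurable
  rw [uIoc_of_le zero_le_one, ← restrict_Ioo_eq_restrict_Ioc]
  filter_upwards [ae_restrict_mem measurableSet_Ioo] with w hw
  have hσ := UnitConvexLoop.sin_pi_mul_pos hw.1 hw.2
  have hpi := pi_pos
  have hw1 : 0 < 1 - w := by linarith [hw.2]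
  rw [Real.norm_of_nonneg (by positivity)]
  have ha : 0 ≤ w ^ (-s) := Real.rpow_nonneg hw.1.le _
  have hb : 0 ≤ (1 - w) ^ (-s) := Real.rpow_nonneg hw1.le _
  rcases le_total w (1 / 2) with h2 | h2
  · have h3 := Real.mul_le_sin (x := π * w) (by have := hw.1; positivity) (by nlinarith)
    have h4 : 2 / π * (π * w) = 2 * w := by field_simp
    have := Real.rpow_le_rpow_of_nonpos hw.1 (show w ≤ Real.sin (π * w) by linarith [hw.1])
      (show -s ≤ 0 by linarith)
    linarith
  · have h3 := Real.mul_le_sin (x := π * (1 - w)) (by positivity) (by nlinarith)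
    have h4 : 2 / π * (π * (1 - w)) = 2 * (1 - w) := by field_simp
    have h5 : Real.sin (π * (1 - w)) = Real.sin (π * w) := by
      rw [mul_sub, mul_one, Real.sin_pi_sub]
    rw [h5] at h3
    have := Real.rpow_le_rpow_of_nonpos hw1 (show 1 - w ≤ Real.sin (π * w) by linarith)
      (show -s ≤ 0 by linarith)
    linarith

theorem setLIntegral_Ioc_comp_one_sub {f : ℝ → ℝ≥0∞} (hf : Measurable f) :
    ∫⁻ w in Ioc (0:ℝ) 1, f (1 - w) = ∫⁻ w in Ioc (0:ℝ) 1, f w := by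
  rw [← restrict_Ioo_eq_restrict_Ioc]
  have hm := volume.measurePreserving_sub_left (1:ℝ)
  rw [← hm.setLIntegral_comp_preimage measurableSet_Ioo hf]
  have : (fun t : ℝ => 1 - t) ⁻¹' Ioo 0 1 = Ioo 0 1 := by
    simp
  rw [this]

namespace UnitConvexLoop

open UnitLoop

variable (c : UnitConvexLoop)

theorem circleDensity_one_sub (q s w : ℝ) : circleDensity q s (1 - w) = circleDensity q s w := by
  rw [circleDensity, circleDensity, mul_sub, mul_one, Real.sin_pi_sub]

theorem lintegral_circleDensity {q s : ℝ} (hs : 0 < s) (h1 : s < 1) :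
    ∫⁻ w in Ioc (0:ℝ) 1, ENNReal.ofReal (circleDensity q s w) =
      ENNReal.ofReal (π ^ (q + s) * ∫ w in (0:ℝ)..1, Real.sin (π * w) ^ (-s)) := by
  have hi := (intervalIntegrable_sin_pi_mul_rpow hs h1).const_mul (π ^ (q + s))
  rw [← intervalIntegral.integral_const_mul, integral_of_le zero_le_one,
    ofReal_integral_eq_lintegral_ofReal hi.1]
  · rfl
  · rw [← restrict_Ioo_eq_restrict_Ioc]
    filter_upwards [ae_restrict_mem measurableSet_Ioo] with w hw
    exact (circleDensity_pos q s hw.1 hw.2).le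

/-- The part of the energy with a fixed parameter distance. -/
def slice (p q w : ℝ) : ℝ≥0∞ := ∫⁻ u in Ioc (0:ℝ) 1, ENNReal.ofReal (c.density p q u w)

theorem measurable_slice (p q : ℝ) : Measurable (c.slice p q) :=
  (ENNReal.measurable_ofReal.comp (c.measurable_density p q)).lintegral_prod_left'

theorem energy_eq_lintegral_slice (p q : ℝ) : c.energy p q = ∫⁻ w in Ioc (0:ℝ) 1, c.slice p q w :=
  lintegral_lintegral_swap (ENNReal.measurable_ofReal.comp (c.measurable_density p q)).aemeasurable

theorem two_mul_energy (p q : ℝ) : 2 * c.energy p q =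
    ∫⁻ w in Ioc (0:ℝ) 1, (c.slice p q w + c.slice p q (1 - w)) := by
  rw [lintegral_add_left (c.measurable_slice p q), setLIntegral_Ioc_comp_one_sub
    (c.measurable_slice p q), ← energy_eq_lintegral_slice, two_mul]

theorem integral_minorant (q s : ℝ) {w : ℝ} (h0 : 0 < w) (h1 : w < 1) :
    IntervalIntegrable (fun u => c.minorant q s u w) volume 0 1 ∧
    ∫ u in (0:ℝ)..1, c.minorant q s u w = circleDensity q s w *
      (1 - q - s + (q + s) * (c.meanVel (1 - w) / π) -
        s * (Real.cos (π * w) / Real.sin (π * w)) * ((∫ u in (0:ℝ)..1, c.angle u w) - π * w)) := by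
  have i1 := c.intervalIntegrable_startVel h0 h1 0 1
  have i2 := c.intervalIntegrable_angle h0.le h1.le
  have k1 := (i1.div_const π).const_mul (q + s)
  have k2 := (i2.sub (intervalIntegrable_const (c := π * w))).const_mul
    (s * (Real.cos (π * w) / Real.sin (π * w)))
  have k0 : IntervalIntegrable (fun _ : ℝ => 1 - q - s) volume 0 1 := intervalIntegrable_const
  refine ⟨((k0.add k1).sub k2).const_mul _, ?_⟩
  simp only [minorant]
  rw [intervalIntegral.integral_const_mul, integral_sub (k0.add k1) k2, integral_add k0 k1,
    intervalIntegral.integral_const_mul, intervalIntegral.integral_const_mul,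
    intervalIntegral.integral_div, integral_startVel, integral_sub i2 intervalIntegrable_const]
  simp

theorem ae_integral_minorant_add (q s : ℝ) : ∀ᵐ w : ℝ, w ∈ Ioo (0:ℝ) 1 →
    (∫ u in (0:ℝ)..1, c.minorant q s u w) + ∫ u in (0:ℝ)..1, c.minorant q s u (1 - w) =
      2 * circleDensity q s w := by
  filter_upwards [c.ae_meanVel_add] with w hw hw2
  have h := hw hw2
  have h1w : 0 < 1 - w ∧ 1 - w < 1 := ⟨by linarith [hw2.2], by linarith [hw2.1]⟩
  rw [(c.integral_minorant q s hw2.1 hw2.2).2, (c.integral_minorant q s h1w.1 h1w.2).2,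
    circleDensity_one_sub, sub_sub_cancel]
  have hA := c.integral_angle_sub hw2.1.le hw2.2.le
  have e1 : Real.sin (π * (1 - w)) = Real.sin (π * w) := by
    rw [mul_sub, mul_one, Real.sin_pi_sub]
  have e2 : Real.cos (π * (1 - w)) = -Real.cos (π * w) := by
    rw [mul_sub, mul_one, Real.cos_pi_sub]
  rw [e1, e2]
  have h3 : c.meanVel w = 2 * π - c.meanVel (1 - w) := by linarith
  have h4 : ∫ u in (0:ℝ)..1, c.angle u w = (∫ u in (0:ℝ)..1, c.angle u (1 - w)) + 2 * π * w - π := by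
    linarith
  rw [h3, h4]
  have := pi_pos
  have := sin_pi_mul_pos hw2.1 hw2.2
  field_simp
  ring

theorem ae_minorant_le {q s w : ℝ} (hq : 1 ≤ q) (hs : 0 < s) (h0 : 0 < w) (h1 : w < 1) :
    ∀ᵐ u : ℝ, c.minorant q s u w ≤ c.density (2 * q + s) q u w := by
  filter_upwards [c.ae_hasDerivAt, c.supp] with u hd hs'
  exact (c.minorant_le hq hs hd hs' h0 h1).1

theorem aestronglyMeasurable_density (p q w : ℝ) (μ : Measure ℝ) :
    AEStronglyMeasurable (fun u => c.density p q u w) μ :=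
  ((c.measurable_density p q).comp measurable_prodMk_right).aestronglyMeasurable

theorem ofReal_integral_minorant_le {q s w : ℝ} (hq : 1 ≤ q) (hs : 0 < s) (h0 : 0 < w)
    (h1 : w < 1) : ENNReal.ofReal (∫ u in (0:ℝ)..1, c.minorant q s u w) ≤
      c.slice (2 * q + s) q w := by
  rw [integral_of_le zero_le_one]
  exact ofReal_integral_le_lintegral_ofReal (c.aestronglyMeasurable_density _ _ _ _)
    (Filter.Eventually.of_forall fun u => c.density_nonneg _ _ u w)
    (c.integral_minorant q s h0 h1).1.1 (ae_restrict_of_ae (c.ae_minorant_le hq hs h0 h1))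

theorem ae_circleDensity_le {q s : ℝ} (hq : 1 ≤ q) (hs : 0 < s) :
    ∀ᵐ w ∂volume.restrict (Ioc (0:ℝ) 1), ENNReal.ofReal (2 * circleDensity q s w) ≤
      c.slice (2 * q + s) q w + c.slice (2 * q + s) q (1 - w) := by
  rw [← restrict_Ioo_eq_restrict_Ioc, ae_restrict_iff' measurableSet_Ioo]
  filter_upwards [c.ae_integral_minorant_add q s] with w hw hw2
  rw [← hw hw2]
  refine ENNReal.ofReal_add_le.trans (add_le_add ?_ ?_)
  · exact c.ofReal_integral_minorant_le hq hs hw2.1 hw2.2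
  · exact c.ofReal_integral_minorant_le hq hs (by linarith [hw2.2]) (by linarith [hw2.1])

theorem lintegral_two_mul_circleDensity (q s : ℝ) :
    ∫⁻ w in Ioc (0:ℝ) 1, ENNReal.ofReal (2 * circleDensity q s w) =
      2 * ∫⁻ w in Ioc (0:ℝ) 1, ENNReal.ofReal (circleDensity q s w) := by
  simp only [ENNReal.ofReal_mul (zero_le_two (α := ℝ)), ENNReal.ofReal_ofNat]
  rw [lintegral_const_mul' _ _ (by norm_num)]

/-- The circle minimizes the tangent-point energy. -/
theorem le_energy {q s : ℝ} (hq : 1 ≤ q) (hs : 0 < s) (hs1 : s < 1) :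
    ENNReal.ofReal (π ^ (q + s) * ∫ w in (0:ℝ)..1, Real.sin (π * w) ^ (-s)) ≤
      c.energy (2 * q + s) q := by
  have h := lintegral_mono_ae (c.ae_circleDensity_le hq hs)
  rw [← two_mul_energy, lintegral_two_mul_circleDensity, lintegral_circleDensity hs hs1] at h
  exact (ENNReal.mul_le_mul_iff_right (by norm_num) (by norm_num)).1 h

theorem ae_ae_angle_eq {q s : ℝ} (hq : 1 ≤ q) (hs : 0 < s) (hs1 : s < 1)
    (h : c.energy (2 * q + s) q =
      ENNReal.ofReal (π ^ (q + s) * ∫ w in (0:ℝ)..1, Real.sin (π * w) ^ (-s))) :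
    ∀ᵐ w ∂volume.restrict (Ioo (0:ℝ) 1), ∀ᵐ u ∂volume.restrict (Ioc (0:ℝ) 1),
      c.angle u w = π * w := by
  have hE : ∫⁻ w in Ioc (0:ℝ) 1, ENNReal.ofReal (2 * circleDensity q s w) =
      2 * c.energy (2 * q + s) q := by
    rw [lintegral_two_mul_circleDensity, lintegral_circleDensity hs hs1, h]
  have hm := (c.measurable_slice (2 * q + s) q).add
    ((c.measurable_slice (2 * q + s) q).comp (measurable_const.sub measurable_id : Measurable
      fun w : ℝ => 1 - w))
  have hae := ae_eq_of_ae_le_of_lintegral_le (c.ae_circleDensity_le hq hs) (by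
    rw [hE, h]
    exact ENNReal.mul_ne_top (by norm_num) ENNReal.ofReal_ne_top) hm.aemeasurable (by
    rw [hE, two_mul_energy])
  rw [← restrict_Ioo_eq_restrict_Ioc] at hae
  filter_upwards [hae, ae_restrict_of_ae (c.ae_integral_minorant_add q s),
    ae_restrict_mem measurableSet_Ioo] with w h1 h2 hw
  have h2 := h2 hw
  have h1w : 0 < 1 - w ∧ 1 - w < 1 := ⟨by linarith [hw.2], by linarith [hw.1]⟩
  have hF := circleDensity_pos q s hw.1 hw.2
  rw [← h2] at h1
  rw [integral_of_le zero_le_one, integral_of_le zero_le_one] at h1 h2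
  have h3 := ae_eq_of_lintegral_add_lintegral_le (c.aestronglyMeasurable_density (2 * q + s) q w _)
    (Filter.Eventually.of_forall fun u => c.density_nonneg _ _ u w)
    (c.integral_minorant q s hw.1 hw.2).1.1 (ae_restrict_of_ae (c.ae_minorant_le hq hs hw.1 hw.2))
    (c.aestronglyMeasurable_density (2 * q + s) q (1 - w) _)
    (Filter.Eventually.of_forall fun u => c.density_nonneg _ _ u (1 - w))
    (c.integral_minorant q s h1w.1 h1w.2).1.1
    (ae_restrict_of_ae (c.ae_minorant_le hq hs h1w.1 h1w.2)) (by rw [h2]; positivity) h1.ge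
  filter_upwards [h3, ae_restrict_of_ae c.ae_hasDerivAt, ae_restrict_of_ae c.supp] with u h4 hd hs'
  exact (c.minorant_le hq hs hd hs' hw.1 hw.2).2 h4

end UnitConvexLoop

theorem ae_of_ae_restrict_of_periodic {P : ℝ → Prop} (hP : ∀ t, P (t + 1) ↔ P t)
    (h : ∀ᵐ t ∂volume.restrict (Ioc (0:ℝ) 1), P t) : ∀ᵐ t, P t := by
  have hper : Function.Periodic P 1 := fun t => propext (hP t)
  have h1 := (ae_restrict_iff' measurableSet_Ioc).1 h
  have h2 : ∀ᵐ t : ℝ, ∀ k : ℤ, k + t ∈ Ioc (0:ℝ) 1 → P (k + t) := by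
    rw [ae_all_iff]
    exact fun k => (measurePreserving_add_left volume (k : ℝ)).quasiMeasurePreserving.ae h1
  filter_upwards [h2] with t ht
  obtain ⟨k, hk, -⟩ := existsUnique_add_zsmul_mem_Ioc zero_lt_one t 0
  simp only [zsmul_eq_mul, mul_one, zero_add] at hk
  have h3 := ht k (by rwa [add_comm])
  have h4 := hper.int_mul k t
  rw [mul_one, add_comm] at h4
  rwa [h4] at h3

namespace UnitConvexLoop

open UnitLoop

variable (c : UnitConvexLoop)

theorem ae_chord_eq {q s : ℝ} (hq : 1 ≤ q) (hs : 0 < s) (hs1 : s < 1)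
    (h : c.energy (2 * q + s) q =
      ENNReal.ofReal (π ^ (q + s) * ∫ w in (0:ℝ)..1, Real.sin (π * w) ^ (-s))) :
    ∀ᵐ u : ℝ, ∀ w ∈ Ioo (0:ℝ) 1,
      c.chord u w = ‖c.chord u w‖ * (c.ζ u * Complex.exp (π * w * Complex.I)) := by
  have hch := c.continuous_chord
  have h1 : ∀ᵐ w ∂volume.restrict (Ioo (0:ℝ) 1), ∀ᵐ u ∂volume.restrict (Ioc (0:ℝ) 1),
      c.chord u w = ‖c.chord u w‖ * (c.ζ u * Complex.exp (π * w * Complex.I)) := by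
    filter_upwards [c.ae_ae_angle_eq hq hs hs1 h, ae_restrict_mem measurableSet_Ioo] with w hw hw2
    filter_upwards [hw, ae_restrict_of_ae c.ae_hasDerivAt, ae_restrict_of_ae c.supp] with u hu hd hs'
    have h2 := ((c.angle_spec hd hs').2 w hw2.1 hw2.2).2.2
    rw [hu] at h2
    have h3 : ((‖c.chord u w‖ : ℝ) : ℂ) ≠ 0 := by
      exact_mod_cast (c.norm_chord_pos u hw2.1 hw2.2).ne'
    push_cast at h2
    rw [← h2, mul_inv_cancel_left₀ h3]
  have hmeas : MeasurableSet {x : ℝ × ℝ | c.chord x.2 x.1 =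
      ‖c.chord x.2 x.1‖ * (c.ζ x.2 * Complex.exp (π * x.1 * Complex.I))} := by
    have hc2 : Measurable fun x : ℝ × ℝ => c.chord x.2 x.1 :=
      hch.measurable.comp measurable_swap
    have hζ := c.meas
    refine measurableSet_eq_fun hc2 ((Complex.measurable_ofReal.comp hc2.norm).mul
      ((hζ.comp measurable_snd).mul ?_))
    have : Continuous fun x : ℝ × ℝ => Complex.exp (π * x.1 * Complex.I) := by fun_prop
    exact this.measurable
  rw [Measure.ae_ae_comm hmeas] at h1
  refine ae_of_ae_restrict_of_periodic (fun t => ?_) ?_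
  · simp only [c.ζ_per t, c.chord_periodic _ t]
  · filter_upwards [h1] with u hu
    have hcw : Continuous fun w => c.chord u w :=
      hch.comp (Continuous.prodMk continuous_const continuous_id)
    exact Measure.eqOn_Ioo_of_ae_eq volume hu hcw.continuousOn (by fun_prop)

/-- Equality characterizes the circle. -/
theorem range_eq_sphere {q s : ℝ} (hq : 1 ≤ q) (hs : 0 < s) (hs1 : s < 1)
    (h : c.energy (2 * q + s) q =
      ENNReal.ofReal (π ^ (q + s) * ∫ w in (0:ℝ)..1, Real.sin (π * w) ^ (-s))) :
    ∃ m r, 0 < r ∧ range c.z = Metric.sphere m r := by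
  have hae := c.ae_chord_eq hq hs hs1 h
  obtain ⟨u, hu⟩ := hae.exists
  have hζ : ∀ᵐ v : ℝ, v ∈ Ioo (0:ℝ) 1 →
      c.ζ (u + v) = c.ζ u * Complex.exp (2 * π * Complex.I * v) := by
    filter_upwards [ae_add_left hae u] with v hv hv2
    have h1v : 1 - v ∈ Ioo (0:ℝ) 1 := ⟨by linarith [hv2.2], by linarith [hv2.1]⟩
    have e1 := hu v hv2
    have e2 := hv (1 - v) h1v
    have e3 : c.chord (u + v) (1 - v) = -c.chord u v := by
      have h : u + v + (1 - v) = u + 1 := by ring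
      rw [chord, chord, h, c.z_per]
      ring
    rw [e3, norm_neg] at e2
    have hn : ((‖c.chord u v‖ : ℝ) : ℂ) ≠ 0 := by
      exact_mod_cast (c.norm_chord_pos u hv2.1 hv2.2).ne'
    have e4 : -((‖c.chord u v‖ : ℂ) * (c.ζ u * Complex.exp (π * v * Complex.I))) =
        ‖c.chord u v‖ * (c.ζ (u + v) * Complex.exp (π * (1 - v : ℝ) * Complex.I)) := by
      rw [← e1, e2]
    have e5 : Complex.exp (π * (1 - v : ℝ) * Complex.I) = -Complex.exp (-(π * v * Complex.I)) := by
      have : (π : ℂ) * (1 - v : ℝ) * Complex.I = π * Complex.I + -(π * v * Complex.I) := by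
        push_cast; ring
      rw [this, Complex.exp_add, Complex.exp_pi_mul_I]
      ring
    rw [e5] at e4
    have e6 : c.ζ u * Complex.exp (π * v * Complex.I) =
        c.ζ (u + v) * Complex.exp (-(π * v * Complex.I)) := by
      have := mul_left_cancel₀ hn (show (‖c.chord u v‖ : ℂ) *
        (c.ζ u * Complex.exp (π * v * Complex.I)) = ‖c.chord u v‖ *
        (c.ζ (u + v) * Complex.exp (-(π * v * Complex.I))) by linear_combination -e4)
      exact this
    have e7 : Complex.exp (2 * π * Complex.I * v) =
        Complex.exp (π * v * Complex.I) * Complex.exp (π * v * Complex.I) := by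
      rw [← Complex.exp_add]; ring_nf
    rw [e7, ← mul_assoc, e6, mul_assoc, ← Complex.exp_add]
    simp
  have hpi : (2 * π * Complex.I : ℂ) ≠ 0 := Complex.two_pi_I_ne_zero
  have hz : ∀ t ∈ Icc (0:ℝ) 1, c.z (u + t) = c.z u - c.ζ u / (2 * π * Complex.I) +
      c.ζ u / (2 * π * Complex.I) * Complex.exp (2 * π * Complex.I * t) := by
    intro t ht
    have e1 : c.chord u t = ∫ v in (0:ℝ)..t, c.ζ u * Complex.exp (2 * π * Complex.I * v) := by
      rw [chord_eq_int, integral_of_le ht.1, integral_of_le ht.1, integral_Ioc_eq_integral_Ioo,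
        integral_Ioc_eq_integral_Ioo]
      refine setIntegral_congr_ae measurableSet_Ioo ?_
      filter_upwards [hζ] with v hv hv2
      exact hv (Ioo_subset_Ioo_right ht.2 hv2)
    rw [intervalIntegral.integral_const_mul, integral_exp_mul_complex hpi] at e1
    rw [chord, sub_eq_iff_eq_add] at e1
    rw [e1]
    simp
    ring
  have hnorm : ‖c.ζ u / (2 * π * Complex.I)‖ = (2 * π)⁻¹ := by
    rw [norm_div, c.norm_one]
    simp [abs_of_pos pi_pos, mul_comm]
  have hne : c.ζ u / (2 * π * Complex.I) ≠ 0 := by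
    rw [← norm_pos_iff, hnorm]
    have := pi_pos
    positivity
  refine ⟨c.z u - c.ζ u / (2 * π * Complex.I), (2 * π)⁻¹, by have := pi_pos; positivity, ?_⟩
  have hexp : ∀ t : ℝ, ‖Complex.exp (2 * π * Complex.I * t)‖ = 1 := fun t => by
    have : (2 * π * Complex.I * t : ℂ) = ((2 * π * t : ℝ) : ℂ) * Complex.I := by push_cast; ring
    rw [this, Complex.norm_exp_ofReal_mul_I]
  ext x
  rw [mem_sphere_iff_norm]
  constructor
  · rintro ⟨y, rfl⟩
    obtain ⟨y', hy', h2⟩ := c.z_per.exists_mem_Ico zero_lt_one y u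
    rw [h2]
    have := hz (y' - u) ⟨by linarith [hy'.1], by linarith [hy'.2]⟩
    rw [add_sub_cancel] at this
    rw [this, add_sub_cancel_left, norm_mul, hnorm, hexp, mul_one]
  · intro hx
    set y := (x - (c.z u - c.ζ u / (2 * π * Complex.I))) / (c.ζ u / (2 * π * Complex.I)) with hy
    have hy1 : ‖y‖ = 1 := by
      rw [hy, norm_div, hx, hnorm]
      have := pi_pos
      field_simp
    obtain ⟨k, hk, -⟩ := existsUnique_add_zsmul_mem_Ioc zero_lt_one (y.arg / (2 * π)) 0
    simp only [zsmul_eq_mul, mul_one, zero_add] at hk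
    refine ⟨u + (y.arg / (2 * π) + k), ?_⟩
    rw [hz _ (Ioc_subset_Icc_self hk)]
    have e1 : Complex.exp (2 * π * Complex.I * (y.arg / (2 * π) + k : ℝ)) = y := by
      have e2 : (2 * π * Complex.I * (y.arg / (2 * π) + k : ℝ) : ℂ) =
          y.arg * Complex.I + k * (2 * π * Complex.I) := by
        have : (π : ℂ) ≠ 0 := by exact_mod_cast pi_ne_zero
        push_cast
        field_simp
      rw [e2, Complex.exp_add, Complex.exp_int_mul_two_pi_mul_I, mul_one]
      have := Complex.norm_mul_exp_arg_mul_I y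
      rwa [hy1, Complex.ofReal_one, one_mul] at this
    rw [e1, hy, mul_div_cancel₀ _ hne]
    ring

end UnitConvexLoop

namespace UnitLoop

variable (c : UnitLoop)

/-- A support line of a convex curve at a point of differentiability is the tangent line. -/
theorem support_of_frontier {K : Set ℂ} (hK : Convex ℝ K) (hr : range c.z = frontier K) {o : ℂ}
    (ho : o ∈ interior K) {u : ℝ} (hd : HasDerivAt c.z (c.ζ u) u) :
    (starRingEnd ℂ (c.ζ u) * (o - c.z u)).im ≠ 0 ∧ ∀ t,
      0 ≤ (starRingEnd ℂ (c.ζ u) * (o - c.z u)).im *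
        (starRingEnd ℂ (c.ζ u) * (c.z t - c.z u)).im := by
  have hfr : ∀ t, c.z t ∈ frontier K := fun t => hr ▸ mem_range_self t
  obtain ⟨f, hf⟩ := geometric_hahn_banach_open_point hK.interior isOpen_interior (hfr u).2
  have hcl : ∀ t, f (c.z t) ≤ f (c.z u) := fun t => by
    have h1 : closure (interior K) ⊆ {x | f x ≤ f (c.z u)} :=
      closure_minimal (fun x hx => (hf x hx).le) (isClosed_le f.continuous continuous_const)
    rw [hK.closure_interior_eq_closure_of_nonempty_interior ⟨o, ho⟩] at h1
    exact h1 (hfr t).1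
  have hz : f (c.ζ u) = 0 := by
    have h1 : IsLocalMax (fun t => f (c.z t)) u := Filter.Eventually.of_forall hcl
    exact h1.hasDerivAt_eq_zero (f.hasFDerivAt.comp_hasDerivAt u hd)
  obtain ⟨κ, hκ⟩ : ∃ κ : ℝ, ∀ x, f x = κ * (starRingEnd ℂ (c.ζ u) * x).im := by
    refine ⟨f (Complex.I * c.ζ u), fun x => ?_⟩
    have h2 : c.ζ u * starRingEnd ℂ (c.ζ u) = 1 := by
      rw [Complex.mul_conj, Complex.normSq_eq_norm_sq, c.norm_one]; simp
    have h3 : x = (starRingEnd ℂ (c.ζ u) * x).re • c.ζ u +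
        (starRingEnd ℂ (c.ζ u) * x).im • (Complex.I * c.ζ u) := by
      rw [Complex.real_smul, Complex.real_smul]
      have := Complex.re_add_im (starRingEnd ℂ (c.ζ u) * x)
      calc x = c.ζ u * (starRingEnd ℂ (c.ζ u) * x) := by rw [← mul_assoc, h2, one_mul]
        _ = _ := by
          conv_lhs => rw [← this]
          ring
    conv_lhs => rw [h3]
    rw [map_add, map_smul, map_smul, hz, smul_zero, zero_add, smul_eq_mul, mul_comm]
  have ho' : κ * (starRingEnd ℂ (c.ζ u) * (o - c.z u)).im < 0 := by
    rw [← hκ, map_sub, sub_neg]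
    exact hf o ho
  refine ⟨fun h => by simp [h] at ho', fun t => ?_⟩
  have ht : κ * (starRingEnd ℂ (c.ζ u) * (c.z t - c.z u)).im ≤ 0 := by
    rw [← hκ, map_sub, sub_nonpos]
    exact hcl t
  have h4 := mul_nonneg_of_nonpos_of_nonpos ho'.le ht
  have hκ0 : κ ≠ 0 := fun h => by simp [h] at ho'
  have h5 : 0 < κ ^ 2 := by positivity
  refine nonneg_of_mul_nonneg_right (a := κ ^ 2) ?_ h5
  linarith

/-- A convex curve meets every ray from an interior point at most once. -/
theorem eq_of_sub_eq_mul {K : Set ℂ} (hK : Convex ℝ K) (hr : range c.z = frontier K) {o : ℂ}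
    (ho : o ∈ interior K) {s t r : ℝ} (h0 : 0 < r) (h : c.z s - o = r * (c.z t - o)) :
    c.z s = c.z t := by
  have hfr : ∀ t, c.z t ∈ frontier K := fun t => hr ▸ mem_range_self t
  have key : ∀ s t r : ℝ, 0 < r → r < 1 → c.z s - o ≠ r * (c.z t - o) := by
    intro s t r h0 h1 h
    refine (hfr s).2 (hK.openSegment_interior_closure_subset_interior ho (hfr t).1
      ⟨1 - r, r, by linarith, h0, by ring, ?_⟩)
    rw [Complex.real_smul, Complex.real_smul]
    push_cast
    linear_combination -h
  rcases lt_trichotomy r 1 with h1 | h1 | h1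
  · exact absurd h (key s t r h0 h1)
  · rw [h1, Complex.ofReal_one, one_mul] at h
    exact sub_left_injective h
  · refine absurd ?_ (key t s r⁻¹ (by positivity) (inv_lt_one_of_one_lt₀ h1))
    rw [h, Complex.ofReal_inv, inv_mul_cancel_left₀ (by exact_mod_cast h0.ne')]

theorem supp_or_supp_neg {K : Set ℂ} (hK : Convex ℝ K) (hK' : (interior K).Nonempty)
    (hr : range c.z = frontier K) :
    (∀ᵐ u : ℝ, ∀ t, 0 ≤ (starRingEnd ℂ (c.ζ u) * (c.z t - c.z u)).im) ∨
      ∀ᵐ u : ℝ, ∀ t, (starRingEnd ℂ (c.ζ u) * (c.z t - c.z u)).im ≤ 0 := by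
  obtain ⟨o, ho⟩ := hK'
  have hne : ∀ t, c.z t - o ≠ 0 := fun t h => by
    have : c.z t ∈ frontier K := hr ▸ mem_range_self t
    rw [sub_eq_zero.1 h] at this
    exact this.2 ho
  obtain ⟨hI, hx⟩ := eq_mul_exp_integral_logDeriv (c := fun t => c.z t - o) (c' := c.ζ) (a := 0)
    (b := 1) (C := 1) zero_le_one c.meas (fun t => (c.norm_one t).le)
    (fun t => by rw [c.eq_int t]; ring) (fun t _ => hne t)
  have hIm : IntervalIntegrable (fun s => (c.ζ s / (c.z s - o)).im) volume 0 1 :=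
    ⟨hI.1.im, hI.2.im⟩
  obtain ⟨h, hh⟩ : ∃ h : ℝ → ℝ, h = fun t => ∫ s in (0:ℝ)..t, (c.ζ s / (c.z s - o)).im := ⟨_, rfl⟩
  have hJ : ∀ t ∈ Icc (0:ℝ) 1, (∫ s in (0:ℝ)..t, c.ζ s / (c.z s - o)).im = h t := fun t ht => by
    rw [hh]
    exact (Complex.imCLM.intervalIntegral_comp_comm (hI.mono_set (by
      rw [uIcc_of_le ht.1, uIcc_of_le zero_le_one]; exact Icc_subset_Icc_right ht.2))).symm
  have hcont : ContinuousOn h (Ioo 0 1) := by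
    have := continuousOn_primitive_interval' hIm left_mem_uIcc
    rw [uIcc_of_le zero_le_one] at this
    rw [hh]
    exact this.mono Ioo_subset_Icc_self
  have hinj : InjOn h (Ioo 0 1) := by
    intro s hs t ht hst
    have e1 := hx s (Ioo_subset_Icc_self hs)
    have e2 := hx t (Ioo_subset_Icc_self ht)
    have j1 := hJ s (Ioo_subset_Icc_self hs)
    have j2 := hJ t (Ioo_subset_Icc_self ht)
    set a := ∫ x in (0:ℝ)..s, c.ζ x / (c.z x - o)
    set b := ∫ x in (0:ℝ)..t, c.ζ x / (c.z x - o)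
    have e3 : Complex.exp a = (Real.exp (a.re - b.re) : ℝ) * Complex.exp b := by
      rw [Complex.ofReal_exp, ← Complex.exp_add]
      congr 1
      apply Complex.ext
      · simp
      · simp [j1, j2, hst]
    obtain ⟨k, hk⟩ := c.inj s t (c.eq_of_sub_eq_mul hK hr ho (Real.exp_pos (a.re - b.re)) (by
      rw [e1, e2, e3]; ring))
    have h1 : (k:ℝ) < 1 := by linarith [hs.2, ht.1]
    have h2 : (-1:ℝ) < k := by linarith [hs.1, ht.2]
    have h1' : k < 1 := by exact_mod_cast h1
    have h2' : -1 < k := by exact_mod_cast h2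
    have h3 : k = 0 := by omega
    rw [h3, Int.cast_zero] at hk
    linarith
  have hder : ∀ᵐ u ∂volume.restrict (Ioo (0:ℝ) 1), HasDerivAt c.z (c.ζ u) u ∧
      HasDerivWithinAt h ((starRingEnd ℂ (c.ζ u) * (o - c.z u)).im / ‖c.z u - o‖ ^ 2) (Ioo 0 1) u ∧
      AccPt u (Filter.principal (Ioo (0:ℝ) 1)) := by
    filter_upwards [ae_restrict_mem measurableSet_Ioo, ae_restrict_of_ae c.ae_hasDerivAt,
      ae_restrict_of_ae hIm.ae_hasDerivAt_integral] with u hu hd hi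
    refine ⟨hd, ?_, uniqueDiffWithinAt_iff_accPt.1 (isOpen_Ioo.uniqueDiffWithinAt hu)⟩
    have := hi (by rw [uIcc_of_le zero_le_one]; exact Ioo_subset_Icc_self hu) 0 left_mem_uIcc
    rw [Complex.im_div_eq, neg_sub, ← hh] at this
    exact this.hasDerivWithinAt
  have hper : ∀ (P : ℝ → Prop) (t : ℝ), (∀ s, P ((starRingEnd ℂ (c.ζ (t + 1)) *
      (c.z s - c.z (t + 1))).im)) ↔ ∀ s, P ((starRingEnd ℂ (c.ζ t) * (c.z s - c.z t)).im) :=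
    fun P t => by rw [c.ζ_per, c.z_per]
  rcases hcont.strictMonoOn_of_injOn_Ioo zero_lt_one hinj with hm | hm
  · left
    refine ae_of_ae_restrict_of_periodic (hper fun x => 0 ≤ x) ?_
    rw [← restrict_Ioo_eq_restrict_Ioc]
    filter_upwards [hder] with u ⟨hd, hw, hacc⟩
    have h1 := hw.nonneg_of_monotoneOn hacc hm.monotoneOn
    obtain ⟨h2, h3⟩ := c.support_of_frontier hK hr ho hd
    have h4 : 0 < ‖c.z u - o‖ ^ 2 := by have := norm_pos_iff.2 (hne u); positivity
    rw [le_div_iff₀ h4, zero_mul] at h1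
    exact fun t => nonneg_of_mul_nonneg_right (h3 t) (lt_of_le_of_ne h1 h2.symm)
  · right
    refine ae_of_ae_restrict_of_periodic (hper fun x => x ≤ 0) ?_
    rw [← restrict_Ioo_eq_restrict_Ioc]
    filter_upwards [hder] with u ⟨hd, hw, hacc⟩
    have h1 := hw.nonpos_of_antitoneOn hacc hm.antitoneOn
    obtain ⟨h2, h3⟩ := c.support_of_frontier hK hr ho hd
    have h4 : 0 < ‖c.z u - o‖ ^ 2 := by have := norm_pos_iff.2 (hne u); positivity
    rw [div_le_iff₀ h4, zero_mul] at h1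
    intro t
    have h5 := lt_of_le_of_ne h1 h2
    by_contra! h6
    exact absurd (h3 t) (not_le.2 (mul_neg_of_neg_of_pos h5 h6))

/-- The mirror image of a loop. -/
def conj : UnitLoop where
  z t := starRingEnd ℂ (c.z t)
  ζ t := starRingEnd ℂ (c.ζ t)
  meas := Complex.continuous_conj.measurable.comp c.meas
  norm_one t := by rw [RCLike.norm_conj, c.norm_one]
  z_per t := by simp only [c.z_per t]
  ζ_per t := by simp only [c.ζ_per t]
  eq_int t := by
    rw [c.eq_int t, map_add]
    congr 1
    exact (Complex.conjCLE.toContinuousLinearMap.intervalIntegral_comp_comm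
      (c.intervalIntegrable 0 t)).symm
  inj s t h := c.inj s t ((starRingEnd ℂ).injective h)

theorem im_conj_mul_conj_sub (u t : ℝ) :
    (starRingEnd ℂ (c.conj.ζ u) * (c.conj.z t - c.conj.z u)).im =
      -(starRingEnd ℂ (c.ζ u) * (c.z t - c.z u)).im := by
  simp only [conj]
  rw [← map_sub, ← map_mul, Complex.conj_im]

theorem energy_conj (p q : ℝ) : c.conj.energy p q = c.energy p q := by
  have h : ∀ u w, c.conj.density p q u w = c.density p q u w := fun u w => by
    rw [density, density, chord, im_conj_mul_conj_sub, abs_neg]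
    congr 2
    simp only [conj, chord]
    rw [← map_sub, RCLike.norm_conj]
  simp only [energy, h]

end UnitLoop

theorem setLIntegral_Ioc_comp_add_left (F : ℝ → ℝ≥0∞) (u : ℝ) :
    ∫⁻ w in Ioc (0:ℝ) 1, F (u + w) = ∫⁻ t in Ioc u (u + 1), F t := by
  have h := (measurePreserving_add_left volume u).setLIntegral_comp_preimage_emb
    (measurableEmbedding_addLeft u) F (Ioc u (u + 1))
  rw [← h]
  simp

/-- A simple closed planar curve with a nowhere vanishing weak derivative. -/
structure PlanarLoop where
  y : ℝ → ℂ
  v : ℝ → ℂ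
  meas : Measurable v
  ne_zero : ∀ t, v t ≠ 0
  y_per : Function.Periodic y 1
  v_per : Function.Periodic v 1
  int : IntervalIntegrable v volume 0 1
  eq_int : ∀ t, y t = y 0 + ∫ s in (0:ℝ)..t, v s
  inj : ∀ s t, y s = y t → ∃ k : ℤ, s - t = k

namespace PlanarLoop

variable (c : PlanarLoop)

/-- The length of a planar loop. -/
def length : ℝ := ∫ s in (0:ℝ)..1, ‖c.v s‖

theorem intervalIntegrable (a b : ℝ) : IntervalIntegrable c.v volume a b :=
  c.v_per.intervalIntegrable₀ one_ne_zero c.int a b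

theorem length_pos : 0 < c.length :=
  intervalIntegral_pos_of_pos (c.int.norm) (fun t => norm_pos_iff.2 (c.ne_zero t)) one_pos

/-- The speed of a planar loop relative to its length. -/
def speed (t : ℝ) : ℝ := ‖c.v t‖ / c.length

theorem speed_pos (t : ℝ) : 0 < c.speed t := div_pos (norm_pos_iff.2 (c.ne_zero t)) c.length_pos

theorem measurable_speed : Measurable c.speed := c.meas.norm.div_const _

theorem intervalIntegrable_speed (a b : ℝ) : IntervalIntegrable c.speed volume a b :=
  (c.intervalIntegrable a b).norm.div_const _

/-- The arc length function of a planar loop, relative to its length. -/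
def arc (t : ℝ) : ℝ := ∫ s in (0:ℝ)..t, c.speed s

theorem arc_sub (a b : ℝ) : c.arc b - c.arc a = ∫ s in a..b, c.speed s :=
  integral_interval_sub_left (c.intervalIntegrable_speed _ _) (c.intervalIntegrable_speed _ _)

theorem arc_zero : c.arc 0 = 0 := integral_same

theorem arc_add_one (t : ℝ) : c.arc (t + 1) = c.arc t + 1 := by
  have hp : Function.Periodic c.speed 1 := fun s => by simp only [speed, c.v_per s]
  have h := c.arc_sub t (t + 1)
  rw [hp.intervalIntegral_add_eq t 0, zero_add] at h
  have h1 : ∫ s in (0:ℝ)..1, c.speed s = 1 := by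
    simp only [speed]
    rw [intervalIntegral.integral_div]
    exact div_self c.length_pos.ne'
  linarith

theorem strictMono_arc : StrictMono c.arc := fun a b hab => by
  rw [← sub_pos, arc_sub]
  exact intervalIntegral_pos_of_pos (c.intervalIntegrable_speed _ _) c.speed_pos hab

theorem continuous_arc : Continuous c.arc :=
  continuous_primitive c.intervalIntegrable_speed 0

theorem arc_intCast (k : ℤ) : c.arc k = k := by
  have hp : Function.Periodic (fun t => c.arc t - t) 1 := fun t => by
    simp only [c.arc_add_one]; ring
  have := hp.int_mul_eq k
  simp only [mul_one, c.arc_zero, sub_zero] at this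
  linarith

theorem surjective_arc : Function.Surjective c.arc := fun x => by
  have h := intermediate_value_Icc (show (⌊x⌋ : ℝ) ≤ ((⌊x⌋ + 1 : ℤ) : ℝ) by push_cast; linarith)
    c.continuous_arc.continuousOn
  rw [arc_intCast, arc_intCast] at h
  push_cast at h
  obtain ⟨t, -, ht⟩ := h ⟨Int.floor_le x, (Int.lt_floor_add_one x).le⟩
  exact ⟨t, ht⟩

/-- The arc length function as a homeomorphism of the line. -/
def arcHomeo : ℝ ≃ₜ ℝ :=
  (c.strictMono_arc.orderIsoOfSurjective c.arc c.surjective_arc).toHomeomorph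

theorem arc_symm (x : ℝ) : c.arc (c.arcHomeo.symm x) = x := c.arcHomeo.apply_symm_apply x

theorem symm_arc (t : ℝ) : c.arcHomeo.symm (c.arc t) = t := c.arcHomeo.symm_apply_apply t

theorem symm_add_one (x : ℝ) : c.arcHomeo.symm (x + 1) = c.arcHomeo.symm x + 1 := by
  apply c.strictMono_arc.injective
  rw [arc_add_one, arc_symm, arc_symm]

theorem measurableEmbedding_arc : MeasurableEmbedding c.arc := c.arcHomeo.measurableEmbedding

theorem preimage_arc_Ioc (a b : ℝ) : c.arc ⁻¹' Ioc (c.arc a) (c.arc b) = Ioc a b := by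
  ext t
  simp [c.strictMono_arc.lt_iff_lt, c.strictMono_arc.le_iff_le]

theorem map_arc :
    (volume.withDensity fun t => ENNReal.ofReal (c.speed t)).map c.arc = volume := by
  refine (Measure.ext_of_Ioc _ _ fun a b hab => ?_).symm
  obtain ⟨a, rfl⟩ := c.surjective_arc a
  obtain ⟨b, rfl⟩ := c.surjective_arc b
  have hab := (c.strictMono_arc.lt_iff_lt.1 hab).le
  rw [c.measurableEmbedding_arc.map_apply, preimage_arc_Ioc, withDensity_apply _ measurableSet_Ioc,
    Real.volume_Ioc, arc_sub, integral_of_le hab,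
    ofReal_integral_eq_lintegral_ofReal ((intervalIntegrable_iff_integrableOn_Ioc_of_le hab).1
      (c.intervalIntegrable_speed a b)) (Filter.Eventually.of_forall fun t => (c.speed_pos t).le)]

theorem setLIntegral_arc {H : ℝ → ℝ≥0∞} (hH : Measurable H) (a b : ℝ) :
    ∫⁻ t in Ioc a b, ENNReal.ofReal (c.speed t) * H (c.arc t) =
      ∫⁻ x in Ioc (c.arc a) (c.arc b), H x := by
  conv_rhs => rw [← c.map_arc]
  rw [c.measurableEmbedding_arc.restrict_map, preimage_arc_Ioc, c.measurableEmbedding_arc.lintegral_map,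
    restrict_withDensity measurableSet_Ioc,
    lintegral_withDensity_eq_lintegral_mul _ c.measurable_speed.ennreal_ofReal
      (g := fun t => H (c.arc t)) (hH.comp c.continuous_arc.measurable)]
  rfl

theorem integral_arc (f : ℝ → ℂ) (a b : ℝ) :
    ∫ t in a..b, c.speed t • f (c.arc t) = ∫ x in (c.arc a)..(c.arc b), f x := by
  have key : ∀ a b, a ≤ b →
      ∫ t in a..b, c.speed t • f (c.arc t) = ∫ x in (c.arc a)..(c.arc b), f x := fun a b hab => by
    rw [integral_of_le hab, integral_of_le (c.strictMono_arc.monotone hab)]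
    conv_rhs => rw [← c.map_arc]
    rw [c.measurableEmbedding_arc.setIntegral_map, preimage_arc_Ioc,
      setIntegral_withDensity_eq_setIntegral_toReal_smul c.measurable_speed.ennreal_ofReal
        (Filter.Eventually.of_forall fun _ => ENNReal.ofReal_lt_top) _ measurableSet_Ioc]
    simp only [ENNReal.toReal_ofReal (c.speed_pos _).le]
  rcases le_total a b with h | h
  · exact key a b h
  · rw [integral_symm, key b a h, ← integral_symm]

/-- The arc length parametrization of a planar loop, scaled to length one. -/
def toUnitLoop : UnitLoop where
  z x := (c.length : ℂ)⁻¹ * c.y (c.arcHomeo.symm x)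
  ζ x := c.v (c.arcHomeo.symm x) / ‖c.v (c.arcHomeo.symm x)‖
  meas := by
    have h := c.meas.comp c.arcHomeo.symm.continuous.measurable
    exact h.div (Complex.measurable_ofReal.comp h.norm)
  norm_one t := by
    rw [norm_div, Complex.norm_real, norm_norm]
    exact div_self (norm_ne_zero_iff.2 (c.ne_zero _))
  z_per x := by simp only [symm_add_one, c.y_per _]
  ζ_per x := by simp only [symm_add_one, c.v_per _]
  eq_int x := by
    obtain ⟨t, rfl⟩ := c.surjective_arc x
    have h0 := c.symm_arc 0
    have hL : (c.length : ℂ) ≠ 0 := by exact_mod_cast c.length_pos.ne'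
    rw [arc_zero] at h0
    have h1 := c.integral_arc (fun x => c.v (c.arcHomeo.symm x) / ‖c.v (c.arcHomeo.symm x)‖) 0 t
    rw [arc_zero] at h1
    rw [← h1, h0, c.symm_arc, c.eq_int t, mul_add, ← intervalIntegral.integral_const_mul]
    congr 2
    funext s
    have h2 : (‖c.v s‖ : ℂ) ≠ 0 := by exact_mod_cast norm_ne_zero_iff.2 (c.ne_zero s)
    rw [symm_arc, speed, Complex.real_smul]
    push_cast
    field_simp
  inj s t h := by
    have hL : (c.length : ℂ)⁻¹ ≠ 0 := inv_ne_zero (by exact_mod_cast c.length_pos.ne')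
    obtain ⟨k, hk⟩ := c.inj _ _ (mul_left_cancel₀ hL h)
    refine ⟨k, ?_⟩
    have hp : Function.Periodic (fun t => c.arc t - t) 1 := fun t => by
      simp only [c.arc_add_one]; ring
    have h1 := (hp.int_mul k) (c.arcHomeo.symm t)
    have h2 : c.arcHomeo.symm t + k * 1 = c.arcHomeo.symm s := by rw [mul_one, ← hk]; ring
    rw [h2] at h1
    simp only [arc_symm] at h1
    linarith

theorem range_toUnitLoop : range c.toUnitLoop.z = (fun ξ => (c.length : ℂ)⁻¹ * ξ) '' range c.y := by
  rw [← range_comp]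
  exact c.arcHomeo.symm.surjective.range_comp (fun t => (c.length : ℂ)⁻¹ * c.y t)

/-- The tangent-point energy of a planar loop. -/
def energy (p q : ℝ) : ℝ≥0∞ :=
  ∫⁻ u in Ioc (0:ℝ) 1, ∫⁻ w in Ioc (0:ℝ) 1, ENNReal.ofReal
    ((|(starRingEnd ℂ (c.v u) * (c.y (u + w) - c.y u)).im| / ‖c.v u‖) ^ q /
      ‖c.y (u + w) - c.y u‖ ^ p * (‖c.v u‖ * ‖c.v (u + w)‖))

theorem integrand_eq (p q u t : ℝ) :
    (|(starRingEnd ℂ (c.v u) * (c.y t - c.y u)).im| / ‖c.v u‖) ^ q /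
      ‖c.y t - c.y u‖ ^ p * (‖c.v u‖ * ‖c.v t‖) =
    c.length ^ (q + 2 - p) * (c.speed u * (c.speed t *
      c.toUnitLoop.density p q (c.arc u) (c.arc t - c.arc u))) := by
  have hL := c.length_pos
  have hu : 0 < ‖c.v u‖ := norm_pos_iff.2 (c.ne_zero u)
  have h1 : c.toUnitLoop.chord (c.arc u) (c.arc t - c.arc u) =
      (c.length : ℂ)⁻¹ * (c.y t - c.y u) := by
    simp only [UnitLoop.chord, toUnitLoop, add_sub_cancel, symm_arc]
    ring
  have h2 : c.toUnitLoop.ζ (c.arc u) = c.v u / ‖c.v u‖ := by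
    simp only [toUnitLoop, symm_arc]
  have h3 : |(starRingEnd ℂ (c.v u / ‖c.v u‖) * ((c.length : ℂ)⁻¹ * (c.y t - c.y u))).im| =
      |(starRingEnd ℂ (c.v u) * (c.y t - c.y u)).im| / ‖c.v u‖ / c.length := by
    have : starRingEnd ℂ (c.v u / ‖c.v u‖) * ((c.length : ℂ)⁻¹ * (c.y t - c.y u)) =
        (((‖c.v u‖⁻¹ * c.length⁻¹ : ℝ)) : ℂ) * (starRingEnd ℂ (c.v u) * (c.y t - c.y u)) := by
      rw [map_div₀, Complex.conj_ofReal]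
      push_cast
      ring
    rw [this, Complex.im_ofReal_mul, abs_mul, abs_of_pos (by positivity)]
    field_simp
  have h4 : ‖(c.length : ℂ)⁻¹ * (c.y t - c.y u)‖ = ‖c.y t - c.y u‖ / c.length := by
    rw [norm_mul, norm_inv, Complex.norm_real, Real.norm_of_nonneg hL.le]
    ring
  rw [UnitLoop.density, h1, h2, h3, h4, Real.div_rpow (by positivity) hL.le (z := q),
    Real.div_rpow (norm_nonneg _) hL.le, speed, speed, Real.rpow_sub hL, Real.rpow_add hL,
    Real.rpow_two]
  have := Real.rpow_pos_of_pos hL p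
  have := Real.rpow_pos_of_pos hL q
  generalize (|(starRingEnd ℂ (c.v u) * (c.y t - c.y u)).im| / ‖c.v u‖) ^ q = A
  generalize ‖c.y t - c.y u‖ ^ p = B
  rcases eq_or_ne B 0 with rfl | hB
  · simp
  · field_simp

theorem energy_eq (p q : ℝ) :
    c.energy p q = ENNReal.ofReal (c.length ^ (q + 2 - p)) * c.toUnitLoop.energy p q := by
  have hL := Real.rpow_nonneg c.length_pos.le (q + 2 - p)
  have hm := (c.toUnitLoop.measurable_density p q).ennreal_ofReal
  have hm' : Measurable fun x => ∫⁻ w in Ioc (0:ℝ) 1,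
      ENNReal.ofReal (c.toUnitLoop.density p q x w) := hm.lintegral_prod_right'
  have hm2 : ∀ x, Measurable fun t =>
      ENNReal.ofReal (c.toUnitLoop.density p q x (t - x)) := fun x => by
    have h : Measurable fun t : ℝ => (x, t - x) := by fun_prop
    exact ((c.toUnitLoop.measurable_density p q).comp h).ennreal_ofReal
  have key : ∀ u, ∫⁻ w in Ioc (0:ℝ) 1, ENNReal.ofReal
      ((|(starRingEnd ℂ (c.v u) * (c.y (u + w) - c.y u)).im| / ‖c.v u‖) ^ q /
      ‖c.y (u + w) - c.y u‖ ^ p * (‖c.v u‖ * ‖c.v (u + w)‖)) =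
      ENNReal.ofReal (c.length ^ (q + 2 - p)) * (ENNReal.ofReal (c.speed u) *
        ∫⁻ w in Ioc (0:ℝ) 1, ENNReal.ofReal (c.toUnitLoop.density p q (c.arc u) w)) := fun u => by
    simp only [integrand_eq, ENNReal.ofReal_mul hL, ENNReal.ofReal_mul (c.speed_pos _).le]
    rw [lintegral_const_mul' _ _ ENNReal.ofReal_ne_top,
      lintegral_const_mul' _ _ ENNReal.ofReal_ne_top,
      setLIntegral_Ioc_comp_add_left (fun t => ENNReal.ofReal (c.speed t) *
        ENNReal.ofReal (c.toUnitLoop.density p q (c.arc u) (c.arc t - c.arc u))),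
      c.setLIntegral_arc (H := fun x => ENNReal.ofReal
        (c.toUnitLoop.density p q (c.arc u) (x - c.arc u))), arc_add_one,
      ← setLIntegral_Ioc_comp_add_left]
    · simp only [add_sub_cancel_left]
    · exact hm2 _
  simp only [energy, key]
  rw [lintegral_const_mul' _ _ ENNReal.ofReal_ne_top, c.setLIntegral_arc hm', arc_zero]
  have := c.arc_add_one 0
  rw [arc_zero, zero_add] at this
  rw [this, UnitLoop.energy]

end PlanarLoop

namespace PlanarLoop

variable (c : PlanarLoop)

open scoped Pointwise in
/-- A convex planar loop, oriented counterclockwise, scaled and reparametrized. -/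
theorem exists_unitConvexLoop {K : Set ℂ} (hK : Convex ℝ K) (hK' : (interior K).Nonempty)
    (hr : range c.y = frontier K) :
    ∃ (d : UnitConvexLoop) (j : ℂ ≃ₗᵢ[ℝ] ℂ),
      range c.y = (fun ξ => c.length • j ξ) '' range d.z ∧
      ∀ p q, c.energy p q = ENNReal.ofReal (c.length ^ (q + 2 - p)) * d.energy p q := by
  have hL : (c.length : ℂ) ≠ 0 := by exact_mod_cast c.length_pos.ne'
  have hr' : range c.y = (fun ξ => c.length • ξ) '' range c.toUnitLoop.z := by
    rw [range_toUnitLoop, image_image]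
    simp [hL]
  have h1 : range c.toUnitLoop.z = frontier (c.length⁻¹ • K) := by
    have h0 : (fun ξ : ℂ => (c.length : ℂ)⁻¹ * ξ) =
        Homeomorph.smulOfNeZero c.length⁻¹ (inv_ne_zero c.length_pos.ne') := by
      funext ξ
      simp
    rw [range_toUnitLoop, hr, h0, Homeomorph.image_frontier]
    rfl
  have h2 : (interior (c.length⁻¹ • K)).Nonempty := by
    rw [interior_smul₀ (inv_ne_zero c.length_pos.ne')]
    exact hK'.smul_set
  rcases c.toUnitLoop.supp_or_supp_neg (hK.smul _) h2 h1 with h | h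
  · refine ⟨⟨c.toUnitLoop, h⟩, LinearIsometryEquiv.refl ℝ ℂ, hr', c.energy_eq⟩
  · refine ⟨⟨c.toUnitLoop.conj, ?_⟩, Complex.conjLIE, ?_, fun p q => ?_⟩
    · filter_upwards [h] with u hu t
      rw [UnitLoop.im_conj_mul_conj_sub]
      exact neg_nonneg.2 (hu t)
    · rw [hr', ← range_comp, ← range_comp]
      congr 1
      funext t
      simp [UnitLoop.conj]
    · rw [energy_eq, ← UnitLoop.energy_conj]

theorem le_energy_of_convex {K : Set ℂ} (hK : Convex ℝ K) (hK' : (interior K).Nonempty)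
    (hr : range c.y = frontier K) {p q : ℝ} (hq : 1 ≤ q) (hp1 : 2 * q < p) (hp2 : p < 2 * q + 1) :
    ENNReal.ofReal (c.length ^ (q + 2 - p) * π ^ (p - q) *
      ∫ w in (0:ℝ)..1, Real.sin (π * w) ^ (2 * q - p)) ≤ c.energy p q := by
  obtain ⟨d, j, -, h⟩ := c.exists_unitConvexLoop hK hK' hr
  have := d.le_energy hq (s := p - 2 * q) (by linarith) (by linarith)
  rw [show q + (p - 2 * q) = p - q by ring, show -(p - 2 * q) = 2 * q - p by ring,
    show 2 * q + (p - 2 * q) = p by ring] at this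
  rw [h, mul_assoc, ENNReal.ofReal_mul (Real.rpow_nonneg c.length_pos.le _)]
  gcongr

open scoped Pointwise in
theorem range_eq_sphere_of_convex {K : Set ℂ} (hK : Convex ℝ K) (hK' : (interior K).Nonempty)
    (hr : range c.y = frontier K) {p q : ℝ} (hq : 1 ≤ q) (hp1 : 2 * q < p) (hp2 : p < 2 * q + 1)
    (he : c.energy p q = ENNReal.ofReal (c.length ^ (q + 2 - p) * π ^ (p - q) *
      ∫ w in (0:ℝ)..1, Real.sin (π * w) ^ (2 * q - p))) :
    ∃ m r, 0 < r ∧ range c.y = Metric.sphere m r := by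
  obtain ⟨d, j, hj, h⟩ := c.exists_unitConvexLoop hK hK' hr
  have hL := c.length_pos
  have := d.range_eq_sphere hq (s := p - 2 * q) (by linarith) (by linarith)
  rw [show q + (p - 2 * q) = p - q by ring, show -(p - 2 * q) = 2 * q - p by ring,
    show 2 * q + (p - 2 * q) = p by ring] at this
  have hL' := Real.rpow_pos_of_pos hL (q + 2 - p)
  rw [h, mul_assoc, ENNReal.ofReal_mul hL'.le] at he
  obtain ⟨m, r, h0, hm⟩ := this ((ENNReal.mul_right_inj (ENNReal.ofReal_pos.2 hL').ne'
    ENNReal.ofReal_ne_top).1 he)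
  refine ⟨c.length • j m, c.length * r, by positivity, ?_⟩
  rw [hj, hm, ← image_image (fun ξ => c.length • ξ) j, j.image_sphere, image_smul,
    smul_sphere' hL.ne', Real.norm_of_nonneg hL.le]

end PlanarLoop

theorem intrinsicFrontier_eq_frontier {K : Set ℂ} (h : affineSpan ℝ K = ⊤) :
    intrinsicFrontier ℝ K = frontier K := by
  have hu : (affineSpan ℝ K : Set ℂ) = univ := by rw [h]; rfl
  have ho : IsOpen (affineSpan ℝ K : Set ℂ) := hu ▸ isOpen_univ
  have h1 := ho.isOpenMap_subtype_val.preimage_frontier_eq_frontier_preimage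
    continuous_subtype_val K
  refine (congrArg (image _) h1.symm).trans ?_
  rw [Subtype.image_preimage_coe, hu, univ_inter]

namespace ClosedCurve

variable {n : ℕ}

/-- A convex curve is planar. -/
theorem IsConvex.exists_planar {γ : ClosedCurve n} (h : γ.IsConvex) :
    ∃ (U : ℂ →ₗᵢ[ℝ] EuclideanSpace ℝ (Fin n)) (y : ℝ → ℂ) (K : Set ℂ), Convex ℝ K ∧
      (interior K).Nonempty ∧ (∀ t, γ.toFun t = γ.toFun 0 + U (y t)) ∧ range y = frontier K := by
  obtain ⟨K, hK, hd, hr⟩ := h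
  set D := (affineSpan ℝ K).direction with hD
  have hmem : ∀ t, γ.toFun t ∈ affineSpan ℝ K := fun t =>
    intrinsicClosure_subset_affineSpan (intrinsicFrontier_subset_intrinsicClosure
      (hr ▸ mem_range_self t))
  let j : ℂ ≃ₗᵢ[ℝ] D :=
    Complex.isometryOfOrthonormal ((stdOrthonormalBasis ℝ D).reindex (finCongr hd))
  let U : ℂ →ₗᵢ[ℝ] EuclideanSpace ℝ (Fin n) := D.subtypeₗᵢ.comp j.toLinearIsometry
  let φ : ℂ →ᵃⁱ[ℝ] EuclideanSpace ℝ (Fin n) :=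
    (AffineIsometryEquiv.vaddConst ℝ (γ.toFun 0)).toAffineIsometry.comp U.toAffineIsometry
  have hφ : ∀ ξ, φ ξ = γ.toFun 0 + U ξ := fun ξ => add_comm _ _
  have hrange : ∀ x ∈ affineSpan ℝ K, ∃ ξ, φ ξ = x := fun x hx => by
    refine ⟨j.symm ⟨x - γ.toFun 0, AffineSubspace.vsub_mem_direction hx (hmem 0)⟩, ?_⟩
    rw [hφ]
    simp [U]
  have hKφ : φ '' (φ ⁻¹' K) = K :=
    image_preimage_eq_of_subset fun x hx => hrange x (subset_affineSpan ℝ K hx)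
  have hKne : K.Nonempty := by
    rw [← affineSpan_nonempty ℝ]
    exact ⟨_, hmem 0⟩
  have hspan : affineSpan ℝ (φ ⁻¹' K) = ⊤ := by
    have hne : (affineSpan ℝ (φ ⁻¹' K) : Set ℂ).Nonempty :=
      (affineSpan_nonempty ℝ).2 ((hKφ ▸ hKne).of_image)
    rw [← AffineSubspace.direction_eq_top_iff_of_nonempty hne]
    refine Submodule.eq_top_of_finrank_eq ?_
    rw [Complex.finrank_real_complex]
    have h1 : (affineSpan ℝ (φ ⁻¹' K)).direction.map φ.linear = D := by
      rw [← AffineSubspace.map_direction, AffineSubspace.map_span, hD]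
      congr 2
    rw [← hd, ← h1]
    exact (Submodule.equivMapOfInjective φ.linear φ.linearIsometry.injective _).finrank_eq
  have hc : Convex ℝ (φ ⁻¹' K) := hK.affine_preimage φ.toAffineMap
  have hr2 : range γ.toFun = φ '' frontier (φ ⁻¹' K) := by
    rw [hr, ← intrinsicFrontier_eq_frontier hspan, ← φ.intrinsicFrontier_image, hKφ]
  choose y hy using fun t => hrange _ (hmem t)
  refine ⟨U, y, φ ⁻¹' K, hc, hc.interior_nonempty_iff_affineSpan_eq_top.2 hspan, fun t => ?_, ?_⟩
  · rw [← hφ, hy]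
  · apply φ.injective.image_injective
    rw [← hr2, ← range_comp]
    exact congrArg range (funext hy)

end ClosedCurve

theorem LinearIsometry.norm_projPerp {F : Type*} [NormedAddCommGroup F] [InnerProductSpace ℝ F]
    (U : ℂ →ₗᵢ[ℝ] F) {a : ℂ} (ha : a ≠ 0) (b : ℂ) :
    ‖projPerp (U a) (U b)‖ = |(starRingEnd ℂ a * b).im| / ‖a‖ := by
  have ha' := norm_pos_iff.2 ha
  rw [projPerp, U.inner_map_map, U.norm_map, ← map_smul, ← map_sub, U.norm_map,
    eq_div_iff ha'.ne', ← Real.norm_eq_abs, ← Complex.norm_real]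
  have h1 : a * starRingEnd ℂ a = (‖a‖ : ℂ) ^ 2 := by
    rw [Complex.mul_conj, Complex.normSq_eq_norm_sq]; simp
  have h2 : ⟪a, b⟫ = (starRingEnd ℂ a * b).re := by
    rw [Complex.inner, mul_comm]
  have h3 : (b - (⟪a, b⟫ / ‖a‖ ^ 2) • a) * starRingEnd ℂ a =
      (starRingEnd ℂ a * b).im * Complex.I := by
    have h4 := Complex.re_add_im (starRingEnd ℂ a * b)
    have h5 : (‖a‖ : ℂ) ≠ 0 := by exact_mod_cast ha'.ne'
    rw [h2, sub_mul, Complex.real_smul, mul_assoc, h1]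
    push_cast
    rw [div_mul_cancel₀ _ (pow_ne_zero 2 h5)]
    linear_combination -h4
  have h6 := congrArg norm h3
  rwa [norm_mul, norm_mul, RCLike.norm_conj, Complex.norm_I, mul_one] at h6

namespace ClosedCurve

variable {n : ℕ}

/-- The planar loop traced by a planar curve. -/
theorem exists_planarLoop {γ : ClosedCurve n} (hinj : γ.IsInj) (hreg : γ.IsRegular)
    (U : ℂ →ₗᵢ[ℝ] EuclideanSpace ℝ (Fin n)) (y : ℝ → ℂ)
    (hy : ∀ t, γ.toFun t = γ.toFun 0 + U (y t)) :
    ∃ c : PlanarLoop, c.y = y ∧ ∀ᵐ t, γ.deriv' t = U (c.v t) := by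
  let P := U.toContinuousLinearMap.adjoint
  have hP : ∀ ξ, P (U ξ) = ξ := fun ξ => by
    refine ext_inner_right ℝ fun η => ?_
    rw [ContinuousLinearMap.adjoint_inner_left]
    exact U.inner_map_map ξ η
  have hint : IntervalIntegrable γ.deriv' volume 0 1 :=
    (intervalIntegrable_iff_integrableOn_Icc_of_le zero_le_one).2 γ.integrableOn
  have hint' : ∀ a b, IntervalIntegrable γ.deriv' volume a b :=
    γ.deriv'_periodic.intervalIntegrable₀ one_ne_zero hint
  have hyP : ∀ t, y t = P (γ.toFun t - γ.toFun 0) := fun t => by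
    rw [hy t, add_sub_cancel_left, hP]
  have hyint : ∀ t, y t = ∫ s in (0:ℝ)..t, P (γ.deriv' s) := fun t => by
    rw [hyP, γ.eq_integral t, add_sub_cancel_left, P.intervalIntegral_comp_comm (hint' 0 t)]
  have hder : ∀ᵐ t, γ.deriv' t = U (P (γ.deriv' t)) := by
    refine ae_of_ae_restrict_of_periodic (fun t => by rw [γ.deriv'_periodic t]) ?_
    rw [ae_restrict_iff' measurableSet_Ioc]
    filter_upwards [hint.ae_hasDerivAt_integral] with t ht hmem
    rw [uIcc_of_le zero_le_one] at ht
    have h1 := (ht (Ioc_subset_Icc_self hmem) 0 (by simp)).const_add (γ.toFun 0)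
    rw [← funext γ.eq_integral] at h1
    have h2 : HasDerivAt (fun t => U (P (γ.toFun t - γ.toFun 0))) (U (P (γ.deriv' t))) t :=
      U.toContinuousLinearMap.hasFDerivAt.comp_hasDerivAt t
        (P.hasFDerivAt.comp_hasDerivAt t (h1.sub_const _))
    have h3 := h2.const_add (γ.toFun 0)
    have h4 : (fun t => γ.toFun 0 + U (P (γ.toFun t - γ.toFun 0))) = γ.toFun := by
      funext t
      rw [← hyP, ← hy]
    rw [h4] at h3
    exact h1.unique h3
  have hm : AEStronglyMeasurable (fun t => P (γ.deriv' t)) (volume.restrict (Icc (0:ℝ) 1)) :=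
    P.continuous.comp_aestronglyMeasurable γ.integrableOn.aestronglyMeasurable
  let f := hm.mk
  have hf : Measurable f := hm.stronglyMeasurable_mk.measurable
  let v : ℝ → ℂ := fun t => if f (Int.fract t) = 0 then 1 else f (Int.fract t)
  have hfr : Measurable fun t : ℝ => f (Int.fract t) := hf.comp measurable_fract
  have hv : Measurable v :=
    Measurable.ite (hfr (measurableSet_singleton 0)) measurable_const hfr
  have hvp : Function.Periodic v 1 := fun t => by simp only [v, Int.fract_add_one]
  have hvae : ∀ᵐ t, γ.deriv' t = U (v t) := by
    refine ae_of_ae_restrict_of_periodic (fun t => by rw [γ.deriv'_periodic t, hvp t]) ?_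
    rw [← restrict_Ioo_eq_restrict_Ioc]
    filter_upwards [ae_restrict_of_ae hder, ae_restrict_of_ae hreg,
      ae_restrict_of_ae_restrict_of_subset Ioo_subset_Icc_self hm.ae_eq_mk,
      ae_restrict_mem measurableSet_Ioo] with t h1 h2 h3 h4
    have h5 : Int.fract t = t := Int.fract_eq_self.2 ⟨h4.1.le, h4.2⟩
    have h6 : f t ≠ 0 := fun h => by
      rw [← show P (γ.deriv' t) = f t from h3] at h
      rw [h, map_zero] at h1
      exact h2 h1
    simp only [v, h5, if_neg h6]
    rw [h1]
    exact congrArg U h3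
  have hvP : ∀ᵐ t, P (γ.deriv' t) = v t := by
    filter_upwards [hvae] with t ht
    rw [ht, hP]
  refine ⟨⟨y, v, hv, fun t => ?_, fun t => ?_, hvp, ?_, fun t => ?_, fun s t h => ?_⟩, rfl, hvae⟩
  · simp only [v]
    split_ifs with h
    · exact one_ne_zero
    · exact h
  · rw [hyP, hyP, γ.periodic]
  · refine IntervalIntegrable.congr_ae ?_ (ae_restrict_of_ae hvP)
    exact ⟨P.integrable_comp hint.1, P.integrable_comp hint.2⟩
  · rw [hyint 0, integral_same, zero_add, hyint]
    exact integral_congr_ae (by filter_upwards [hvP] with s hs _ using hs)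
  · exact hinj s t (by rw [hy s, hy t, h])

theorem length_eq_of_planar {γ : ClosedCurve n} {U : ℂ →ₗᵢ[ℝ] EuclideanSpace ℝ (Fin n)}
    {c : PlanarLoop} (h : ∀ᵐ t, γ.deriv' t = U (c.v t)) : γ.length = c.length := by
  refine integral_congr_ae ?_
  filter_upwards [h] with t ht _
  rw [ht, U.norm_map]

theorem tp_eq_of_planar {γ : ClosedCurve n} {U : ℂ →ₗᵢ[ℝ] EuclideanSpace ℝ (Fin n)}
    {c : PlanarLoop} (hy : ∀ t, γ.toFun t = γ.toFun 0 + U (c.y t))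
    (h : ∀ᵐ t, γ.deriv' t = U (c.v t)) (p q : ℝ) : TP p q γ = c.energy p q := by
  refine lintegral_congr_ae (ae_restrict_of_ae ?_)
  filter_upwards [h] with u hu
  refine lintegral_congr_ae (ae_restrict_of_ae ?_)
  filter_upwards [ae_add_left h u] with w hw
  rw [hu, hw, hy (u + w), hy u, add_sub_add_left_eq_sub, ← map_sub,
    U.norm_projPerp (c.ne_zero u), U.norm_map, U.norm_map, U.norm_map]

/-- A convex curve is the isometric image of a convex planar loop. -/
theorem IsConvex.exists_planarLoop {γ : ClosedCurve n} (h : γ.IsConvex) (hinj : γ.IsInj)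
    (hreg : γ.IsRegular) :
    ∃ (c : PlanarLoop) (U : ℂ →ₗᵢ[ℝ] EuclideanSpace ℝ (Fin n)) (K : Set ℂ), Convex ℝ K ∧
      (interior K).Nonempty ∧ range c.y = frontier K ∧
      (∀ t, γ.toFun t = γ.toFun 0 + U (c.y t)) ∧ γ.length = c.length ∧
      ∀ p q, TP p q γ = c.energy p q := by
  obtain ⟨U, y, K, hK, hK', hy, hr⟩ := h.exists_planar
  obtain ⟨c, rfl, hc⟩ := ClosedCurve.exists_planarLoop hinj hreg U y hy
  exact ⟨c, U, K, hK, hK', hr, hy, length_eq_of_planar hc, tp_eq_of_planar hy hc⟩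

end ClosedCurve

theorem LinearIsometry.isCircle_image_sphere {F : Type*} [NormedAddCommGroup F]
    [InnerProductSpace ℝ F] (U : ℂ →ₗᵢ[ℝ] F) (x : F) (m : ℂ) {r : ℝ} (hr : 0 < r) :
    IsCircle ((fun ξ => x + U ξ) '' Metric.sphere m r) := by
  refine ⟨x + U m, r, LinearMap.range U.toLinearMap, hr, ?_, ?_⟩
  · rw [LinearMap.finrank_range_of_inj U.injective, Complex.finrank_real_complex]
  · ext z
    constructor
    · rintro ⟨ξ, hξ, rfl⟩
      rw [mem_sphere_iff_norm] at hξ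
      simp only [mem_ofPred_eq, add_sub_add_left_eq_sub, ← map_sub, U.norm_map]
      exact ⟨hξ, ⟨ξ - m, rfl⟩⟩
    · rintro ⟨h1, ⟨η, hη⟩⟩
      replace hη : U η = z - (x + U m) := hη
      refine ⟨m + η, ?_, ?_⟩
      · rw [mem_sphere_iff_norm, add_sub_cancel_left, ← h1, ← hη, U.norm_map]
      · simp only [map_add, hη]
        abel

/-- For `q ≥ 1`, `p ∈ (2q, 2q+1)`: among convex curves of length `L`, the value
`L^{q+2−p} π^{p−q} ∫₀¹ sin(πw)^{2q−p} dw` is a lower bound for `TP^{(p,q)}`, and any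
convex curve attaining it has a round circle as image. -/
theorem tp_convex_regime {n : ℕ} (p q L : ℝ) (hq : 1 ≤ q) (hp1 : 2 * q < p)
    (hp2 : p < 2 * q + 1) (hL : 0 < L) (γ : ClosedCurve n) (hinj : γ.IsInj)
    (hreg : γ.IsRegular) (hconv : γ.IsConvex) (hlen : γ.length = L)
    (heq : TP p q γ = ENNReal.ofReal (L ^ (q + 2 - p) * π ^ (p - q) * ∫ w in (0:ℝ)..1, Real.sin (π * w) ^ (2 * q - p))) :
    IsCircle (Set.range γ.toFun) ∧
    ∀ γ' : ClosedCurve n, γ'.IsInj → γ'.IsRegular → γ'.IsConvex → γ'.length = L →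
      ENNReal.ofReal (L ^ (q + 2 - p) * π ^ (p - q) * ∫ w in (0:ℝ)..1, Real.sin (π * w) ^ (2 * q - p)) ≤ TP p q γ' := by
  constructor
  · obtain ⟨c, U, K, hK, hK', hr, hy, hl, ht⟩ := hconv.exists_planarLoop hinj hreg
    rw [← hlen, hl, ht] at heq
    obtain ⟨m, r, h0, hm⟩ := c.range_eq_sphere_of_convex hK hK' hr hq hp1 hp2 heq
    have h1 := U.isCircle_image_sphere (γ.toFun 0) m h0
    rw [← hm, ← range_comp] at h1
    rwa [funext hy]
  · intro γ' hinj' hreg' hconv' hlen'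
    obtain ⟨c, U, K, hK, hK', hr, -, hl, ht⟩ := hconv'.exists_planarLoop hinj' hreg'
    rw [← hlen', hl, ht]
    exact c.le_energy_of_convex hK hK' hr hq hp1 hp2

end
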